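/- Let k > 30 be a P-integer, set T = φ(k) + ω(k), and let t = ⌊p_T / k⌋. Then t < log(k · log k). -/

import Mathlib

open scoped BigOperators

/-- Number of primes not exceeding the real number `x` (so `primePi x = 0` for `x ≤ 1`). -/
noncomputable def primePi (x : ℝ) : ℕ :=
  ((Finset.range (⌊x⌋₊ + 1)).filter Nat.Prime).card

/-- The `n`-th prime, with `nthPrime 1 = 2`, `nthPrime 2 = 3`, etc. -/
noncomputable def nthPrime (n : ℕ) : ℕ := Nat.nth Nat.Prime (n - 1)
/-- The `i`-th (0-indexed) prime not dividing `k`, in increasing order. -/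
noncomputable def nthPrimeNotDvd (k i : ℕ) : ℕ := Nat.nth (fun p => p.Prime ∧ ¬ p ∣ k) i

/-- `k` is a `P`-integer: `k > 1` and the first `φ(k)` primes not dividing `k` are pairwise
incongruent modulo `k` and their residues are exactly the residues coprime to `k`. -/
def IsPInteger (k : ℕ) : Prop :=
  1 < k ∧
  Set.InjOn (fun i => nthPrimeNotDvd k i % k) (Set.Iio k.totient) ∧
  (fun i => nthPrimeNotDvd k i % k) '' Set.Iio k.totient = {r | r < k ∧ Nat.Coprime r k}

namespace PIntegerBound

lemma primeCounting_mul_div_le (k T : ℕ) (hT : 0 < T) :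
    Nat.primeCounting (nthPrime T / k * k) ≤ T := by
  classical
  have h1 : nthPrime T / k * k ≤ nthPrime T := Nat.div_mul_le_self _ _
  refine (Nat.monotone_primeCounting h1).trans ?_
  unfold nthPrime Nat.primeCounting Nat.primeCounting'
  rw [Nat.count_nth_succ_of_infinite Nat.infinite_setOfPred_prime]
  omega

lemma IsPInteger.exists_prime_in_class {k T : ℕ} (hP : IsPInteger k)
    (hT : T = k.totient + k.primeFactors.card) {r : ℕ} (hr : r < k) (hc : Nat.Coprime r k) :
    ∃ i ≤ nthPrime T / k, (r + i * k).Prime := by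
  classical
  obtain ⟨hk, -, hs⟩ := hP
  have hmem : r ∈ {r | r < k ∧ Nat.Coprime r k} := ⟨hr, hc⟩
  rw [← hs] at hmem
  obtain ⟨i, hi, hir⟩ := hmem
  have hi : i < k.totient := hi
  have hφ : 0 < k.totient := Nat.totient_pos.2 (by omega)
  have hinf : {p : ℕ | p.Prime ∧ ¬ p ∣ k}.Infinite := by
    have : {p : ℕ | p.Prime ∧ ¬ p ∣ k} = {p | p.Prime} \ (k.primeFactors : Set ℕ) := by
      ext p
      simp only [Set.mem_ofPred_eq, Set.mem_sdiff, Finset.mem_coe, Nat.mem_primeFactors]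
      constructor
      · rintro ⟨a, b⟩; exact ⟨a, fun h => b h.2.1⟩
      · rintro ⟨a, b⟩; exact ⟨a, fun h => b ⟨a, h, by omega⟩⟩
    rw [this]
    exact Nat.infinite_setOfPred_prime.sdiff (Finset.finite_toSet _)
  have hp := Nat.nth_mem_of_infinite hinf i
  set p := nthPrimeNotDvd k i with hpdef
  have hpp : p.Prime := hp.1
  have hcount : Nat.count Nat.Prime (nthPrime T + 1) = T := by
    unfold nthPrime
    rw [Nat.count_nth_succ_of_infinite Nat.infinite_setOfPred_prime]; omega
  have hle : p < nthPrime T + 1 := by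
    apply Nat.nth_lt_of_lt_count
    have : Nat.count Nat.Prime (nthPrime T + 1) ≤
        Nat.count (fun p => p.Prime ∧ ¬ p ∣ k) (nthPrime T + 1) + k.primeFactors.card := by
      rw [Nat.count_eq_card_filter_range, Nat.count_eq_card_filter_range]
      refine (Finset.card_le_card ?_).trans (Finset.card_union_le _ _)
      intro q hq
      simp only [Finset.mem_filter, Finset.mem_union, Nat.mem_primeFactors] at hq ⊢
      by_cases h : q ∣ k
      · right; exact ⟨hq.2, h, by omega⟩
      · left; exact ⟨hq.1, hq.2, h⟩
    omega
  refine ⟨p / k, Nat.div_le_div_right (by omega), ?_⟩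
  have : r + p / k * k = p := by
    have h := Nat.div_add_mod p k
    have h2 : p % k = r := hir
    rw [h2] at h; linarith [mul_comm k (p / k)]
  rw [this]; exact hpp

end PIntegerBound

namespace PIntegerBound

open Finset

lemma exists_large_residue_class (W : Finset ℕ) {q : ℕ} (hq : 0 < q) :
    ∃ a : ℕ, ((W.filter fun w => ¬ w ≡ a [MOD q]).card : ℝ) ≤ W.card * (1 - 1 / (q : ℝ)) := by
  classical
  have hmaps : ∀ w ∈ W, w % q ∈ range q := fun w _ => mem_range.2 (Nat.mod_lt _ hq)
  obtain ⟨a, ha, hle⟩ : ∃ a ∈ range q,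
      (W.card : ℝ) / q ≤ ((W.filter fun w => w % q = a).card : ℝ) := by
    have hne : (range q).Nonempty := ⟨0, mem_range.2 hq⟩
    have hsum : ∑ a ∈ range q, ((W.card : ℝ) / q) ≤
        ∑ a ∈ range q, ((W.filter fun w => w % q = a).card : ℝ) := by
      rw [sum_const, card_range, nsmul_eq_mul, ← Nat.cast_sum,
        ← card_eq_sum_card_fiberwise (fun w hw => hmaps w hw)]
      have : (q : ℝ) ≠ 0 := by positivity
      field_simp; rfl
    exact exists_le_of_sum_le hne hsum
  refine ⟨a, ?_⟩
  have h1 := card_filter_add_card_filter_not (s := W) (fun w => w ≡ a [MOD q])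
  have h2 : (W.filter fun w => w % q = a) = W.filter fun w => w ≡ a [MOD q] := by
    apply filter_congr
    intro w _
    rw [Nat.ModEq, Nat.mod_eq_of_lt (mem_range.1 ha)]
  rw [h2] at hle
  have h3 : ((W.filter fun w => w ≡ a [MOD q]).card : ℝ) +
    ((W.filter fun w => ¬ w ≡ a [MOD q]).card : ℝ) = W.card := by exact_mod_cast h1
  have h4 : (W.card : ℝ) * (1 - 1 / q) = W.card - W.card / q := by ring
  rw [h4]; linarith

lemma exists_residues_avoiding (R : Finset ℕ) (hR : ∀ q ∈ R, 0 < q) (W : Finset ℕ) :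
    ∃ a : ℕ → ℕ, ((W.filter fun w => ∀ q ∈ R, ¬ w ≡ a q [MOD q]).card : ℝ) ≤
      W.card * ∏ q ∈ R, (1 - 1 / (q : ℝ)) := by
  classical
  induction R using Finset.induction_on with
  | empty => exact ⟨fun _ => 0, by simp⟩
  | insert q R hqR ih =>
    obtain ⟨a, ha⟩ := ih fun q hq => hR q (mem_insert_of_mem hq)
    obtain ⟨b, hb⟩ := exists_large_residue_class
      (W.filter fun w => ∀ q ∈ R, ¬ w ≡ a q [MOD q]) (hR q (mem_insert_self _ _))
    refine ⟨Function.update a q b, ?_⟩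
    have hq1 : (0 : ℝ) ≤ 1 - 1 / (q : ℝ) := by
      have : (1 : ℝ) ≤ q := by exact_mod_cast hR q (mem_insert_self _ _)
      rw [sub_nonneg, div_le_one (by linarith)]; exact this
    have heq : (W.filter fun w => ∀ p ∈ insert q R, ¬ w ≡ Function.update a q b p [MOD p]) =
        (W.filter fun w => ∀ q ∈ R, ¬ w ≡ a q [MOD q]).filter fun w => ¬ w ≡ b [MOD q] := by
      rw [filter_filter]
      apply filter_congr
      intro w _
      rw [forall_mem_insert, Function.update_self, and_comm]
      refine and_congr_left fun _ => forall₂_congr fun p hp => ?_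
      rw [Function.update_of_ne (by rintro rfl; exact hqR hp)]
    rw [heq, prod_insert hqR]
    calc _ ≤ _ := hb
      _ ≤ (W.card * ∏ q ∈ R, (1 - 1 / (q : ℝ))) * (1 - 1 / (q : ℝ)) :=
        mul_le_mul_of_nonneg_right ha hq1
      _ = _ := by ring

lemma card_filter_dvd_le {p Q r N : ℕ} (hp : p.Prime) (hQ : ¬ p ∣ Q) :
    ((Ico 2 (N + 2)).filter fun j => p ∣ r + Q * j).card ≤ (N + 1) / p + 1 := by
  have : ((Ico 2 (N + 2)).filter fun j => p ∣ r + Q * j).card ≤ (range ((N + 1) / p + 1)).card := by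
    apply card_le_card_of_injOn (fun j => j / p)
    · intro j hj
      simp only [coe_filter, mem_Ico, Set.mem_ofPred_eq] at hj
      simp only [coe_range, Set.mem_Iio]
      have : j / p ≤ (N + 1) / p := Nat.div_le_div_right (by omega)
      omega
    · intro i hi j hj hij
      simp only [coe_filter, mem_Ico, Set.mem_ofPred_eq] at hi hj
      have h1 : r + Q * i ≡ r + Q * j [MOD p] :=
        ((Nat.modEq_zero_iff_dvd).2 hi.2).trans ((Nat.modEq_zero_iff_dvd).2 hj.2).symm
      have h2 : Q * i ≡ Q * j [MOD p] := Nat.ModEq.add_left_cancel' r h1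
      have h3 : i ≡ j [MOD p] :=
        Nat.ModEq.cancel_left_of_coprime ((Nat.Prime.coprime_iff_not_dvd hp).2 hQ) h2
      have h4 := Nat.div_add_mod i p
      have h5 := Nat.div_add_mod j p
      simp only at hij
      rw [hij, h3] at h4
      omega
  simpa using this

/-- If residues of `i` modulo primes not dividing `k` cover `0, …, t`, but every coprime residue
class modulo `k` has a prime among its first `t + 1` members, then `k` is small. -/
theorem lt_of_residue_cover {k t : ℕ} (hk : 1 < k)
    (hcls : ∀ r < k, Nat.Coprime r k → ∃ i ≤ t, (r + i * k).Prime)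
    (hs : ∑ p ∈ k.primeFactors, (1 / p : ℝ) ≤ 1 / 4)
    (A : Finset ℕ) (hA : ∀ q ∈ A, q.Prime ∧ ¬ q ∣ k) (a : ℕ → ℕ)
    (hcov : ∀ i ≤ t, ∃ q ∈ A, i ≡ a q [MOD q]) :
    k < (∏ q ∈ A, q) * (2 * k.primeFactors.card + 3) := by
  classical
  by_contra! hlt
  set Q := ∏ q ∈ A, q with hQ
  set ω := k.primeFactors.card with hω
  have hQpos : 0 < Q := prod_pos fun q hq => (hA q hq).1.pos
  have hcop : Set.Pairwise (A : Set ℕ) (Function.onFun Nat.Coprime fun q => q) := by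
    intro p hp q hq hpq
    exact (Nat.coprime_primes (hA p hp).1 (hA q hq).1).2 hpq
  obtain ⟨r₀, hr₀⟩ := Nat.chineseRemainderOfFinset (fun q => (q - 1) * (a q * k)) (fun q => q) A
    (fun q hq => (hA q hq).1.ne_zero) hcop
  have hr₀Q : r₀ % Q < Q := Nat.mod_lt _ hQpos
  set r₁ := r₀ % Q with hr₁
  have hdvd : ∀ q ∈ A, ∀ j i, i ≡ a q [MOD q] → q ∣ (r₁ + Q * j) + i * k := by
    intro q hq j i hi
    have hqQ : q ∣ Q := dvd_prod_of_mem _ hq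
    have e1 : r₁ ≡ (q - 1) * (a q * k) [MOD q] :=
      ((Nat.mod_modEq r₀ Q).of_dvd hqQ).trans (hr₀ q hq)
    have e2 : r₁ + Q * j + i * k ≡ (q - 1) * (a q * k) + 0 + a q * k [MOD q] := by
      refine (e1.add ?_).add (hi.mul_right k)
      exact (Nat.modEq_zero_iff_dvd).2 (hqQ.mul_right j)
    refine (Nat.modEq_zero_iff_dvd).1 (e2.trans ?_)
    refine (Nat.modEq_zero_iff_dvd).2 ⟨a q * k, ?_⟩
    have : 1 ≤ q := (hA q hq).1.pos
    obtain ⟨m, rfl⟩ := Nat.exists_eq_add_of_le this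
    simp; ring
  set N := 2 * ω + 1 with hN
  obtain ⟨j, hj, hjc⟩ : ∃ j ∈ Ico 2 (N + 2), ∀ p ∈ k.primeFactors, ¬ p ∣ r₁ + Q * j := by
    by_contra! hcon
    have hsub : Ico 2 (N + 2) ⊆
        k.primeFactors.biUnion fun p => (Ico 2 (N + 2)).filter fun j => p ∣ r₁ + Q * j := by
      intro j hj
      obtain ⟨p, hp, hpj⟩ := hcon j hj
      exact mem_biUnion.2 ⟨p, hp, mem_filter.2 ⟨hj, hpj⟩⟩
    have h1 : (N : ℝ) ≤ ∑ p ∈ k.primeFactors, (((N + 1) / p + 1 : ℕ) : ℝ) := by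
      have : N ≤ ∑ p ∈ k.primeFactors, ((N + 1) / p + 1) := by
        calc N = (Ico 2 (N + 2)).card := by simp
          _ ≤ _ := card_le_card hsub
          _ ≤ _ := card_biUnion_le
          _ ≤ _ := by
            refine sum_le_sum fun p hp => card_filter_dvd_le (Nat.prime_of_mem_primeFactors hp) ?_
            intro hpQ
            obtain ⟨q, hq, hpq⟩ := (Prime.dvd_finsetProd_iff
              (Nat.prime_of_mem_primeFactors hp).prime _).1 hpQ
            have := (Nat.prime_dvd_prime_iff_eq
              (Nat.prime_of_mem_primeFactors hp) (hA q hq).1).1 hpq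
            subst this
            exact (hA p hq).2 (Nat.dvd_of_mem_primeFactors hp)
      exact_mod_cast this
    have h2 : ∑ p ∈ k.primeFactors, (((N + 1) / p + 1 : ℕ) : ℝ) ≤
        ∑ p ∈ k.primeFactors, (((N : ℝ) + 1) * (1 / p : ℝ) + 1) := by
      refine sum_le_sum fun p _ => ?_
      push_cast
      have := @Nat.cast_div_le ℝ _ _ _ (N + 1) p
      push_cast at this
      have e : ((N : ℝ) + 1) * (1 / p : ℝ) = ((N : ℝ) + 1) / p := by ring
      rw [e]; linarith
    rw [sum_add_distrib, ← mul_sum, sum_const, nsmul_eq_mul, mul_one, ← hω] at h2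
    have h3 : ((N : ℝ) + 1) * ∑ p ∈ k.primeFactors, (1 / p : ℝ) ≤ ((N : ℝ) + 1) * (1 / 4) :=
      mul_le_mul_of_nonneg_left hs (by positivity)
    have h4 : (N : ℝ) = 2 * ω + 1 := by rw [hN]; push_cast; ring
    have h5 : (0 : ℝ) ≤ ω := by positivity
    linarith
  rw [mem_Ico] at hj
  set r := r₁ + Q * j with hr
  have hrk : r < k := by
    have : Q * (j + 1) ≤ Q * (2 * ω + 3) := Nat.mul_le_mul_left _ (by omega)
    rw [mul_add, mul_one] at this
    omega
  have hrQ : 2 * Q ≤ r := by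
    have : Q * 2 ≤ Q * j := Nat.mul_le_mul_left _ hj.1
    omega
  have hrc : Nat.Coprime r k := by
    rw [Nat.coprime_iff_gcd_eq_one]
    by_contra hg
    obtain ⟨p, hp, hpg⟩ := Nat.exists_prime_and_dvd hg
    exact hjc p (Nat.mem_primeFactors.2 ⟨hp, hpg.trans (Nat.gcd_dvd_right _ _), by omega⟩)
      (hpg.trans (Nat.gcd_dvd_left _ _))
  obtain ⟨i, hi, hip⟩ := hcls r hrk hrc
  obtain ⟨q, hq, hiq⟩ := hcov i hi
  have hqd := hdvd q hq j i hiq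
  have heq := (Nat.prime_dvd_prime_iff_eq (hA q hq).1 hip).1 hqd
  have hqQ : q ≤ Q := Nat.le_of_dvd hQpos (dvd_prod_of_mem _ hq)
  have : 0 ≤ i * k := Nat.zero_le _
  omega

/-- Completing a partial covering with one fresh prime for each uncovered element. -/
theorem lt_of_partial_cover {k t : ℕ} (hk : 1 < k)
    (hcls : ∀ r < k, Nat.Coprime r k → ∃ i ≤ t, (r + i * k).Prime)
    (hs : ∑ p ∈ k.primeFactors, (1 / p : ℝ) ≤ 1 / 4)
    (A : Finset ℕ) (hA : ∀ q ∈ A, q.Prime ∧ ¬ q ∣ k) (a : ℕ → ℕ)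
    (F : Finset ℕ) (hF : ∀ q ∈ F, q.Prime ∧ ¬ q ∣ k) (hAF : Disjoint A F) {B u : ℕ}
    (hFB : ∀ q ∈ F, q ≤ B) (hB : 1 ≤ B)
    (hU : ((range (t + 1)).filter fun i => ∀ q ∈ A, ¬ i ≡ a q [MOD q]).card ≤ u)
    (huF : u ≤ F.card) :
    k < (∏ q ∈ A, q) * B ^ u * (2 * k.primeFactors.card + 3) := by
  classical
  set U := (range (t + 1)).filter fun i => ∀ q ∈ A, ¬ i ≡ a q [MOD q] with hUdef
  obtain ⟨F', hF'F, hF'card⟩ := exists_subset_card_eq (hU.trans huF)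
  have e : U ≃ F' := Finset.equivOfCardEq hF'card.symm
  set b : ℕ → ℕ := fun q => if h : q ∈ F' then (e.symm ⟨q, h⟩ : ℕ) else a q with hb
  have hdisj : Disjoint A F' := disjoint_of_subset_right hF'F hAF
  have h := lt_of_residue_cover hk hcls hs (A ∪ F') (by
    intro q hq
    rcases mem_union.1 hq with h | h
    · exact hA q h
    · exact hF q (hF'F h)) b (by
    intro i hi
    by_cases hiU : i ∈ U
    · refine ⟨e ⟨i, hiU⟩, mem_union_right _ (e ⟨i, hiU⟩).2, ?_⟩
      rw [hb]
      simp [Nat.ModEq.refl]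
    · rw [hUdef, mem_filter, not_and] at hiU
      have := hiU (mem_range.2 (by omega))
      push Not at this
      obtain ⟨q, hq, hiq⟩ := this
      refine ⟨q, mem_union_left _ hq, ?_⟩
      have : q ∉ F' := fun h => (Finset.disjoint_left.1 hdisj) hq h
      simpa [hb, this] using hiq)
  rw [prod_union hdisj] at h
  refine h.trans_le (Nat.mul_le_mul_right _ (Nat.mul_le_mul_left _ ?_))
  calc ∏ q ∈ F', q ≤ B ^ F'.card := prod_le_pow_card _ _ _ fun q hq => hFB q (hF'F hq)
    _ ≤ B ^ u := by rw [hF'card]; exact Nat.pow_le_pow_right hB hU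

end PIntegerBound

namespace PIntegerBound

open Finset

/-- The `n ∈ [1, M]` all of whose prime factors lie in `R`. -/
def smoothUpTo (R : Finset ℕ) (M : ℕ) : Finset ℕ :=
  (Icc 1 M).filter fun n => ∀ p ∈ n.primeFactors, p ∈ R

lemma card_smoothUpTo_empty (M : ℕ) : (smoothUpTo ∅ M).card ≤ 1 := by
  refine (card_le_card (t := {1}) ?_).trans (by simp)
  intro n hn
  simp only [smoothUpTo, mem_filter, mem_Icc, notMem_empty, imp_false] at hn
  rw [mem_singleton]
  by_contra h
  obtain ⟨p, hp, hpn⟩ := Nat.exists_prime_and_dvd h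
  exact hn.2 p (Nat.mem_primeFactors.2 ⟨hp, hpn, by omega⟩)

lemma card_smoothUpTo_insert_le (R : Finset ℕ) {q : ℕ} (hq : q.Prime) (M : ℕ) :
    (smoothUpTo (insert q R) M).card ≤ (Nat.log q M + 1) * (smoothUpTo R M).card := by
  classical
  have hsub : smoothUpTo (insert q R) M ⊆
      ((range (Nat.log q M + 1)) ×ˢ smoothUpTo R M).image fun x => q ^ x.1 * x.2 := by
    intro n hn
    simp only [smoothUpTo, mem_filter, mem_Icc] at hn
    obtain ⟨⟨h1, hM⟩, hpf⟩ := hn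
    obtain ⟨e, m, hqm, hnm⟩ := Nat.exists_eq_pow_mul_and_not_dvd (n := n) (by omega) q hq.ne_one
    have hm0 : m ≠ 0 := by rintro rfl; simp at hqm
    rw [mem_image]
    refine ⟨(e, m), ?_, hnm.symm⟩
    rw [mem_product]
    constructor
    · rw [mem_range]
      have : q ^ e ≤ M := (Nat.le_of_dvd (by omega) ⟨m, hnm⟩).trans hM
      have := Nat.le_log_of_pow_le hq.one_lt this
      simp only; omega
    · simp only [smoothUpTo, mem_filter, mem_Icc]
      have hmn : m ∣ n := ⟨q ^ e, by rw [hnm]; ring⟩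
      refine ⟨⟨by omega, (Nat.le_of_dvd (by omega) hmn).trans hM⟩, fun p hp => ?_⟩
      have hp' := Nat.mem_primeFactors.1 hp
      have := hpf p (Nat.mem_primeFactors.2 ⟨hp'.1, hp'.2.1.trans hmn, by omega⟩)
      rcases mem_insert.1 this with h | h
      · exact absurd (h ▸ hp'.2.1) hqm
      · exact h
  refine (card_le_card hsub).trans (card_image_le.trans ?_)
  rw [card_product, card_range]

lemma card_filter_primeFactors_le {k : ℕ} (hk : k ≠ 0) (R : Finset ℕ) (M : ℕ) :
    (((Icc 1 M).filter fun n => ∀ p ∈ n.primeFactors, p ∈ R ∨ p ∣ k).card : ℝ) ≤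
      (smoothUpTo R M).card + M * ∑ p ∈ k.primeFactors, (1 / p : ℝ) := by
  classical
  have hsub : ((Icc 1 M).filter fun n => ∀ p ∈ n.primeFactors, p ∈ R ∨ p ∣ k) ⊆
      smoothUpTo R M ∪ k.primeFactors.biUnion fun p => (Ioc 0 M).filter fun n => p ∣ n := by
    intro n hn
    simp only [mem_filter, mem_Icc] at hn
    obtain ⟨⟨h1, hM⟩, h⟩ := hn
    by_cases hR : ∀ p ∈ n.primeFactors, p ∈ R
    · exact mem_union_left _ (mem_filter.2 ⟨mem_Icc.2 ⟨h1, hM⟩, hR⟩)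
    · push Not at hR
      obtain ⟨p, hp, hpR⟩ := hR
      have hp' := Nat.mem_primeFactors.1 hp
      refine mem_union_right _ (mem_biUnion.2 ⟨p, Nat.mem_primeFactors.2
        ⟨hp'.1, (h p hp).resolve_left hpR, hk⟩, mem_filter.2 ⟨mem_Ioc.2 ⟨by omega, hM⟩, hp'.2.1⟩⟩)
  have h1 := (card_le_card hsub).trans ((card_union_le _ _).trans
    (Nat.add_le_add_left card_biUnion_le _))
  simp only [Nat.Ioc_filter_dvd_card_eq_div] at h1
  have h2 : (((Icc 1 M).filter fun n => ∀ p ∈ n.primeFactors, p ∈ R ∨ p ∣ k).card : ℝ) ≤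
      (smoothUpTo R M).card + ∑ p ∈ k.primeFactors, ((M / p : ℕ) : ℝ) := by exact_mod_cast h1
  refine h2.trans (add_le_add_right ?_ _)
  rw [mul_sum]
  refine sum_le_sum fun p _ => ?_
  rw [mul_one_div]
  exact Nat.cast_div_le

lemma prod_le_primorial {A : Finset ℕ} {M : ℕ} (hA : ∀ q ∈ A, q.Prime) (hAM : ∀ q ∈ A, q ≤ M) :
    ∏ q ∈ A, q ≤ primorial M := by
  refine prod_le_prod_of_subset_of_one_le' (fun q hq => ?_) fun q hq _ => ?_
  · simpa [Nat.lt_succ_iff] using ⟨hAM q hq, hA q hq⟩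
  · exact (mem_filter.1 hq).2.one_lt.le

/-- Covering `0, …, t` by the class of the middle modulo the primes up to `M ≥ t / 2`, with the
primes in `R` set aside for an averaging argument. -/
theorem lt_of_centred_cover {k t M B u : ℕ} (hk : 1 < k)
    (hcls : ∀ r < k, Nat.Coprime r k → ∃ i ≤ t, (r + i * k).Prime)
    (hs : ∑ p ∈ k.primeFactors, (1 / p : ℝ) ≤ 1 / 4) (htM : t ≤ 2 * M)
    (R : Finset ℕ) (hR : ∀ q ∈ R, q.Prime ∧ ¬ q ∣ k ∧ q ≤ M)
    (hC : ∃ q ≤ M, q.Prime ∧ ¬ q ∣ k ∧ q ∉ R)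
    (F : Finset ℕ) (hF : ∀ q ∈ F, q.Prime ∧ ¬ q ∣ k ∧ M < q ∧ q ≤ B) (hB : 1 ≤ B)
    (hu : 2 * (((Icc 1 M).filter fun n => ∀ p ∈ n.primeFactors, p ∈ R ∨ p ∣ k).card : ℝ) *
      ∏ q ∈ R, (1 - 1 / (q : ℝ)) < u + 1)
    (huF : u ≤ F.card) :
    k < primorial M * B ^ u * (2 * k.primeFactors.card + 3) := by
  classical
  set Y := (Icc 1 M).filter fun n => ∀ p ∈ n.primeFactors, p ∈ R ∨ p ∣ k with hY
  set C := (range (M + 1)).filter fun q => q.Prime ∧ ¬ q ∣ k ∧ q ∉ R with hCdef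
  set W := (range (t + 1)).filter fun i => ∀ q ∈ C, ¬ i ≡ M [MOD q] with hW
  have hWY : W.card ≤ 2 * Y.card := by
    have hsub : W ⊆ Y.image (fun n => M + n) ∪ Y.image (fun n => M - n) := by
      intro i hi
      rw [hW, mem_filter, mem_range] at hi
      obtain ⟨hit, hiC⟩ := hi
      rw [mem_union, mem_image, mem_image]
      rcases lt_trichotomy i M with h | h | h
      · right
        refine ⟨M - i, ?_, by omega⟩
        rw [hY, mem_filter, mem_Icc]
        refine ⟨by omega, fun p hp => ?_⟩
        have hp' := Nat.mem_primeFactors.1 hp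
        by_contra hcon
        push Not at hcon
        have hle := Nat.le_of_dvd (by omega) hp'.2.1
        refine hiC p (mem_filter.2 ⟨mem_range.2 (by omega), hp'.1, hcon.2, hcon.1⟩) ?_
        exact (Nat.modEq_iff_dvd' h.le).2 hp'.2.1
      · subst h
        obtain ⟨q, hq1, hq2, hq3, hq4⟩ := hC
        exact absurd (Nat.ModEq.refl _)
          (hiC q (mem_filter.2 ⟨mem_range.2 (by omega), hq2, hq3, hq4⟩))
      · left
        refine ⟨i - M, ?_, by omega⟩
        rw [hY, mem_filter, mem_Icc]
        refine ⟨by omega, fun p hp => ?_⟩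
        have hp' := Nat.mem_primeFactors.1 hp
        by_contra hcon
        push Not at hcon
        have hle := Nat.le_of_dvd (by omega) hp'.2.1
        refine hiC p (mem_filter.2 ⟨mem_range.2 (by omega), hp'.1, hcon.2, hcon.1⟩) ?_
        exact ((Nat.modEq_iff_dvd' h.le).2 hp'.2.1).symm
    have := (card_le_card hsub).trans (card_union_le _ _)
    have h1 : (Y.image fun n => M + n).card ≤ Y.card := card_image_le
    have h2 : (Y.image fun n => M - n).card ≤ Y.card := card_image_le
    omega
  obtain ⟨b, hb⟩ := exists_residues_avoiding R (fun q hq => (hR q hq).1.pos) W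
  set a : ℕ → ℕ := fun q => if q ∈ R then b q else M with ha
  have hVnn : (0 : ℝ) ≤ ∏ q ∈ R, (1 - 1 / (q : ℝ)) := by
    refine prod_nonneg fun q hq => ?_
    have : (1 : ℝ) ≤ q := by exact_mod_cast (hR q hq).1.pos
    rw [sub_nonneg, div_le_one (by linarith)]; exact this
  have hCR : ∀ q ∈ C, q ∉ R := fun q hq => (mem_filter.1 hq).2.2.2
  have hprime : ∀ q ∈ C ∪ R, q.Prime ∧ ¬ q ∣ k := by
    intro q hq
    rcases mem_union.1 hq with h | h
    · exact ⟨(mem_filter.1 h).2.1, (mem_filter.1 h).2.2.1⟩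
    · exact ⟨(hR q h).1, (hR q h).2.1⟩
  have hleM : ∀ q ∈ C ∪ R, q ≤ M := by
    intro q hq
    rcases mem_union.1 hq with h | h
    · have := mem_range.1 (mem_filter.1 h).1; omega
    · exact (hR q h).2.2
  have hU : ((range (t + 1)).filter fun i => ∀ q ∈ C ∪ R, ¬ i ≡ a q [MOD q]).card ≤ u := by
    have heq : ((range (t + 1)).filter fun i => ∀ q ∈ C ∪ R, ¬ i ≡ a q [MOD q]) =
        W.filter fun w => ∀ q ∈ R, ¬ w ≡ b q [MOD q] := by
      rw [hW, filter_filter]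
      apply filter_congr
      intro i _
      simp only [mem_union, or_imp, forall_and]
      refine and_congr (forall₂_congr fun q hq => ?_) (forall₂_congr fun q hq => ?_)
      · rw [ha]; simp [hCR q hq]
      · rw [ha]; simp [hq]
    rw [heq]
    have h1 : ((W.filter fun w => ∀ q ∈ R, ¬ w ≡ b q [MOD q]).card : ℝ) < u + 1 := by
      refine (hb.trans (mul_le_mul_of_nonneg_right ?_ hVnn)).trans_lt hu
      exact_mod_cast hWY
    have h2 : (W.filter fun w => ∀ q ∈ R, ¬ w ≡ b q [MOD q]).card < u + 1 := by exact_mod_cast h1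
    omega
  have := lt_of_partial_cover hk hcls hs (C ∪ R) hprime a F
    (fun q hq => ⟨(hF q hq).1, (hF q hq).2.1⟩)
    (disjoint_left.2 fun q hq hq' => absurd (hleM q hq) (not_le.2 (hF q hq').2.2.1))
    (fun q hq => (hF q hq).2.2.2) hB hU huF
  refine this.trans_le (Nat.mul_le_mul_right _ (Nat.mul_le_mul_right _ ?_))
  exact prod_le_primorial (fun q hq => (hprime q hq).1) hleM

/-- Covering `0, …, t` by well-chosen classes modulo the primes up to `z`. -/
theorem lt_of_averaged_cover {k t z B u : ℕ} (hk : 1 < k)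
    (hcls : ∀ r < k, Nat.Coprime r k → ∃ i ≤ t, (r + i * k).Prime)
    (hs : ∑ p ∈ k.primeFactors, (1 / p : ℝ) ≤ 1 / 4)
    (F : Finset ℕ) (hF : ∀ q ∈ F, q.Prime ∧ ¬ q ∣ k ∧ z < q ∧ q ≤ B) (hB : 1 ≤ B)
    (hu : (t + 1 : ℝ) * ∏ q ∈ (range (z + 1)).filter (fun q => q.Prime ∧ ¬ q ∣ k),
      (1 - 1 / (q : ℝ)) < u + 1)
    (huF : u ≤ F.card) :
    k < primorial z * B ^ u * (2 * k.primeFactors.card + 3) := by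
  classical
  set R := (range (z + 1)).filter (fun q => q.Prime ∧ ¬ q ∣ k) with hR
  have hR1 : ∀ q ∈ R, q.Prime ∧ ¬ q ∣ k := fun q hq => (mem_filter.1 hq).2
  have hR2 : ∀ q ∈ R, q ≤ z := fun q hq => by
    have := mem_range.1 (mem_filter.1 hq).1; omega
  obtain ⟨a, ha⟩ := exists_residues_avoiding R (fun q hq => (hR1 q hq).1.pos) (range (t + 1))
  have hU : ((range (t + 1)).filter fun i => ∀ q ∈ R, ¬ i ≡ a q [MOD q]).card ≤ u := by
    rw [card_range] at ha
    push_cast at ha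
    have := ha.trans_lt hu
    have h2 : ((range (t + 1)).filter fun i => ∀ q ∈ R, ¬ i ≡ a q [MOD q]).card < u + 1 := by
      exact_mod_cast this
    omega
  have := lt_of_partial_cover hk hcls hs R hR1 a F (fun q hq => ⟨(hF q hq).1, (hF q hq).2.1⟩)
    (disjoint_left.2 fun q hq hq' => absurd (hR2 q hq) (not_le.2 (hF q hq').2.2.1))
    (fun q hq => (hF q hq).2.2.2) hB hU huF
  refine this.trans_le (Nat.mul_le_mul_right _ (Nat.mul_le_mul_right _ ?_))
  exact prod_le_primorial (fun q hq => (hR1 q hq).1) hR2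

end PIntegerBound

namespace PIntegerBound

open Finset Chebyshev
open scoped Nat ArithmeticFunction.vonMangoldt

lemma log_factorial_eq_sum (n : ℕ) :
    Real.log (n ! : ℝ) = ∑ d ∈ Icc 1 n, Λ d * ((n / d : ℕ) : ℝ) := by
  have h := ArithmeticFunction.sum_Ioc_mul_zeta_eq_sum Λ n
  rw [ArithmeticFunction.vonMangoldt_mul_zeta] at h
  have e : Ioc 0 n = Icc 1 n := by ext; simp [Nat.lt_iff_add_one_le]
  rw [e] at h
  rw [← h]
  clear h e
  induction n with
  | zero => simp
  | succ n ih =>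
    rw [sum_Icc_succ_top (by omega), ← ih, Nat.factorial_succ, Nat.cast_mul,
      Real.log_mul (by positivity) (by positivity), ArithmeticFunction.log_apply, add_comm]

lemma log_factorial_eq_sum_of_le {n N : ℕ} (h : n ≤ N) :
    Real.log (n ! : ℝ) = ∑ d ∈ Icc 1 N, Λ d * ((n / d : ℕ) : ℝ) := by
  rw [log_factorial_eq_sum]
  refine sum_subset (Icc_subset_Icc_right h) fun d hd hd' => ?_
  have : n < d := by simp at hd hd'; omega
  simp [Nat.div_eq_of_lt this]

/-- `∑ b * (m % n)` over the pairs `(n, b)` of a list. The definition is by `List.rec`, to be fast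
in the kernel. -/
noncomputable def modSum (l : List (ℕ × ℕ)) : ℕ → ℕ :=
  List.rec (motive := fun _ => ℕ → ℕ) (fun _ => 0)
    (fun p _ ih m => Nat.add (Nat.mul p.2 (Nat.mod m p.1)) (ih m)) l

lemma modSum_nil (m : ℕ) : modSum [] m = 0 := rfl

lemma modSum_cons (n b : ℕ) (l : List (ℕ × ℕ)) (m : ℕ) :
    modSum ((n, b) :: l) m = b * (m % n) + modSum l m := rfl

/-- `∑ b * F n` over the pairs `(n, b)` of a list. -/
noncomputable def weightedSum : List (ℕ × ℕ) → (ℕ → ℝ) → ℝ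
  | [], _ => 0
  | (n, b) :: l, F => b * F n + weightedSum l F

lemma weightedSum_le {l : List (ℕ × ℕ)} {F G : ℕ → ℝ} (h : ∀ p ∈ l, F p.1 ≤ G p.1) :
    weightedSum l F ≤ weightedSum l G := by
  induction l with
  | nil => simp [weightedSum]
  | cons p l ih =>
    obtain ⟨n, b⟩ := p
    simp only [List.forall_mem_cons] at h
    have := ih h.2
    simp only [weightedSum]
    gcongr
    exact h.1

lemma weightedSum_add (l : List (ℕ × ℕ)) (F G : ℕ → ℝ) :
    weightedSum l (fun n => F n + G n) = weightedSum l F + weightedSum l G := by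
  induction l with
  | nil => simp [weightedSum]
  | cons p l ih => simp only [weightedSum, ih]; ring

lemma weightedSum_const_mul (l : List (ℕ × ℕ)) (c : ℝ) (F : ℕ → ℝ) :
    weightedSum l (fun n => c * F n) = c * weightedSum l F := by
  induction l with
  | nil => simp [weightedSum]
  | cons p l ih => simp only [weightedSum, ih]; ring

lemma sum_vonMangoldt_mul_modSum (l : List (ℕ × ℕ)) (N : ℕ) :
    ∑ d ∈ Icc 1 N, Λ d * (modSum l (N / d) : ℝ) =
      weightedSum l fun n => Real.log (N ! : ℝ) - n * Real.log ((N / n)! : ℝ) := by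
  induction l with
  | nil => simp [modSum_nil, weightedSum]
  | cons p l ih =>
    obtain ⟨n, b⟩ := p
    simp only [modSum_cons, weightedSum]
    rw [← ih, log_factorial_eq_sum_of_le le_rfl, log_factorial_eq_sum_of_le (Nat.div_le_self N n),
      mul_sum, ← sum_sub_distrib, mul_sum, ← sum_add_distrib]
    refine sum_congr rfl fun d _ => ?_
    have h : ((N / d % n : ℕ) : ℝ) = ((N / d : ℕ) : ℝ) - n * ((N / n / d : ℕ) : ℝ) := by
      rw [Nat.div_div_eq_div_mul, mul_comm n d, ← Nat.div_div_eq_div_mul, eq_sub_iff_add_eq]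
      exact_mod_cast Nat.mod_add_div _ _
    push_cast [h]
    ring

lemma log_factorial_le {n : ℕ} (hn : n ≠ 0) :
    Real.log (n ! : ℝ) ≤ n * Real.log n - n + Real.log n / 2 + 1 := by
  obtain ⟨m, rfl⟩ := Nat.exists_eq_succ_of_ne_zero hn
  have h1 : Stirling.stirlingSeq (m + 1) ≤ Stirling.stirlingSeq 1 :=
    Stirling.stirlingSeq'_antitone (Nat.zero_le m)
  have h2 := Real.log_le_log (Stirling.stirlingSeq'_pos m) h1
  rw [Stirling.log_stirlingSeq_formula, Stirling.log_stirlingSeq_formula] at h2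
  have h3 : ((m + 1 : ℕ) : ℝ) ≠ 0 := by positivity
  rw [Real.log_mul two_ne_zero h3, Real.log_div h3 (Real.exp_ne_zero 1), Real.log_exp] at h2
  simp [Real.log_exp] at h2
  simp only [Nat.succ_eq_add_one]
  push_cast
  linarith

/-- `log ⌊y⌋! = y log y - y + O(log y)` with an explicit error term. -/
lemma abs_log_factorial_floor_sub_le {N n : ℕ} (hn : 0 < n) (h : n ≤ N) :
    |n * Real.log ((N / n)! : ℝ) - N * (Real.log N - Real.log n - 1)| ≤
      n * (Real.log N / 2 + 1) := by
  have hN : 0 < N := hn.trans_le h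
  have hn' : (0 : ℝ) < n := by exact_mod_cast hn
  have hN' : (0 : ℝ) < N := by exact_mod_cast hN
  set m := N / n with hm
  set y : ℝ := N / n with hy
  have hm1 : 1 ≤ m := (Nat.one_le_div_iff hn).2 h
  have hm1' : (1 : ℝ) ≤ m := by exact_mod_cast hm1
  have hmy : (m : ℝ) ≤ y := Nat.cast_div_le
  have hym : y < m + 1 := by
    rw [hy, div_lt_iff₀ hn']
    have := Nat.lt_div_mul_add (a := N) hn
    have h2 : N < (m + 1) * n := by rw [add_mul, one_mul]; exact this
    exact_mod_cast h2
  have hy0 : 0 < y := by linarith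
  have hly : Real.log y = Real.log N - Real.log n := Real.log_div hN'.ne' hn'.ne'
  have hlyN : Real.log y ≤ Real.log N := by
    rw [hly]; have : 0 ≤ Real.log n := Real.log_natCast_nonneg n
    linarith
  have hml : 0 ≤ Real.log m := Real.log_natCast_nonneg m
  have hml2 : Real.log m ≤ Real.log y := Real.log_le_log (by linarith) hmy
  have hml3 : Real.log y ≤ Real.log m + 0.7 := by
    have : Real.log y ≤ Real.log (2 * m) := Real.log_le_log hy0 (by linarith)
    rw [Real.log_mul two_ne_zero (by linarith)] at this
    linarith [Real.log_two_lt_d9]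
  have hm0 : (0 : ℝ) < m := by linarith
  have hconv : y * Real.log m - y ≤ y * Real.log y - y := by
    have := mul_le_mul_of_nonneg_left hml2 hy0.le
    linarith
  have key : y * Real.log y - y ≤ m * Real.log m - m + Real.log y := by
    have h1 : m * (Real.log y - Real.log m) ≤ y - m := by
      have := Real.log_le_sub_one_of_pos (div_pos hy0 hm0)
      rw [Real.log_div hy0.ne' hm0.ne'] at this
      have h2 := mul_le_mul_of_nonneg_left this hm0.le
      have h3 : (m : ℝ) * (y / m - 1) = y - m := by field_simp
      linarith
    have h2 : (y - m) * Real.log y ≤ 1 * Real.log y :=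
      mul_le_mul_of_nonneg_right (by linarith) (by linarith)
    nlinarith
  have key2 : m * Real.log m - m ≤ y * Real.log y - y := by
    have h1 : y - m ≤ y * (Real.log y - Real.log m) := by
      have := Real.log_le_sub_one_of_pos (div_pos hm0 hy0)
      rw [Real.log_div hm0.ne' hy0.ne'] at this
      have h2 := mul_le_mul_of_nonneg_left this hy0.le
      have h3 : (y : ℝ) * (m / y - 1) = m - y := by field_simp
      linarith
    have h2 : 0 ≤ (y - m) * Real.log m := mul_nonneg (by linarith) hml
    nlinarith
  have hup := log_factorial_le (n := m) (by omega)
  have hlo := Stirling.le_log_factorial_stirling (n := m) (by omega)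
  have hpi : 0.6 ≤ Real.log (2 * Real.pi) / 2 := by
    have : Real.log 4 ≤ Real.log (2 * Real.pi) :=
      Real.log_le_log (by norm_num) (by linarith [Real.pi_gt_three])
    have h4 : Real.log 4 = 2 * Real.log 2 := by
      rw [show (4 : ℝ) = 2 ^ 2 by norm_num, Real.log_pow]; norm_num
    linarith [Real.log_two_gt_d9]
  have habs : |Real.log (m ! : ℝ) - (y * Real.log y - y)| ≤ Real.log N / 2 + 1 := by
    rw [abs_le]; constructor <;> linarith
  have : n * Real.log (m ! : ℝ) - N * (Real.log N - Real.log n - 1) =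
      n * (Real.log (m ! : ℝ) - (y * Real.log y - y)) := by
    rw [hly, hy]; field_simp
  rw [this, abs_mul, abs_of_pos hn']
  gcongr

end PIntegerBound

namespace PIntegerBound

open Finset Chebyshev
open scoped Nat ArithmeticFunction.vonMangoldt

lemma lcmUpto_succ (n : ℕ) : Nat.lcmUpto (n + 1) = Nat.lcm (Nat.lcmUpto n) (n + 1) := by
  rw [Nat.lcmUpto, ← insert_Icc_right_eq_Icc_add_one (by omega), lcm_insert, Nat.lcm_comm]
  rfl

/-- Check `lcmUpto m ≤ 4 ^ m` for the `f` values of `m` from `n` on, given `L = lcmUpto n`. -/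
def lcmBounded : ℕ → ℕ → ℕ → Bool
  | 0, _, _ => true
  | f + 1, n, L => Nat.ble L (4 ^ n) && lcmBounded f (n + 1) (Nat.lcm L (n + 1))

lemma lcmUpto_le_of_lcmBounded {f n : ℕ} (h : lcmBounded f n (Nat.lcmUpto n) = true) {m : ℕ}
    (hm : n ≤ m) (hmf : m < n + f) : Nat.lcmUpto m ≤ 4 ^ m := by
  induction f generalizing n with
  | zero => omega
  | succ f ih =>
    rw [lcmBounded, Bool.and_eq_true, ← lcmUpto_succ] at h
    rcases hm.eq_or_lt with rfl | hm
    · exact Nat.le_of_ble_eq_true h.1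
    · exact ih h.2 hm (by omega)

lemma lcmUpto_le_four_pow (n : ℕ) (hn : n < 460) : Nat.lcmUpto n ≤ 4 ^ n := by
  have h0 : Nat.lcmUpto 0 = 1 := by simp [Nat.lcmUpto]
  refine lcmUpto_le_of_lcmBounded (f := 460) (n := 0) ?_ n.zero_le (by omega)
  rw [h0]
  decide +kernel

lemma psi_natCast_le (n : ℕ) : ψ n ≤ 1.5 * n := by
  induction n using Nat.strong_induction_on with
  | _ n ih =>
    have h4 : Real.log 4 = 2 * Real.log 2 := by
      rw [show (4 : ℝ) = 2 ^ 2 by norm_num, Real.log_pow]; norm_num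
    rcases lt_or_ge n 460 with hn | hn
    · rw [psi_eq_log_lcmUpto]
      have h1 : (Nat.lcmUpto n : ℝ) ≤ 4 ^ n := by exact_mod_cast lcmUpto_le_four_pow n hn
      have h2 := Real.log_le_log (by exact_mod_cast Nat.lcmUpto_pos n) h1
      rw [Real.log_pow, h4] at h2
      have : (n : ℝ) * (2 * Real.log 2) ≤ n * 1.5 := by
        gcongr; linarith [Real.log_two_lt_d9]
      linarith
    · have hn' : (460 : ℝ) ≤ n := by exact_mod_cast hn
      have aux : ∀ y : ℝ, 0 ≤ y → y < n → ψ y ≤ 1.5 * y := fun y hy hyn => by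
        rw [psi_eq_psi_coe_floor]
        have := ih ⌊y⌋₊ ((Nat.floor_lt hy).2 hyn)
        have := Nat.floor_le hy
        linarith
      have hpow : ∀ a : ℝ, a < 1 → (n : ℝ) ^ a < n := fun a ha => by
        conv_rhs => rw [← Real.rpow_one (n : ℝ)]
        exact Real.rpow_lt_rpow_of_exponent_lt (by linarith) ha
      have hb : ∀ a : ℝ, 0 ≤ (n : ℝ) ^ a := fun a => by positivity
      have h := psi_sub_theta_le_psi_add_psi_add_psi n
      have t := theta_le_log4_mul_x (Nat.cast_nonneg (α := ℝ) n)
      have e2 := aux _ (hb _) (hpow (2 : ℝ)⁻¹ (by norm_num))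
      have e3 := aux _ (hb _) (hpow (3 : ℝ)⁻¹ (by norm_num))
      have e5 := aux _ (hb _) (hpow (5 : ℝ)⁻¹ (by norm_num))
      have root : ∀ (m : ℕ) (c : ℝ), m ≠ 0 → 0 ≤ c → (n : ℝ) ≤ (c * n) ^ m →
          (n : ℝ) ^ ((m : ℝ)⁻¹) ≤ c * n := fun m c hm hc h => by
        rw [Real.rpow_inv_le_iff_of_pos (by positivity) (by positivity) (by positivity)]
        exact_mod_cast h
      have big : ∀ (m : ℕ) (c : ℝ), 0 ≤ c → 1 ≤ c ^ (m + 1) * 460 ^ m →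
          (n : ℝ) ≤ (c * n) ^ (m + 1) := fun m c hc h => by
        have : (460 : ℝ) ^ m ≤ (n : ℝ) ^ m := by gcongr
        calc (n : ℝ) = 1 * n := by ring
          _ ≤ (c ^ (m + 1) * 460 ^ m) * n := by gcongr
          _ ≤ (c ^ (m + 1) * n ^ m) * n := by gcongr
          _ = _ := by ring
      have r2 := root 2 0.0467 (by norm_num) (by norm_num) (big 1 _ (by norm_num) (by norm_num))
      have r3 := root 3 0.0168 (by norm_num) (by norm_num) (big 2 _ (by norm_num) (by norm_num))
      have r5 := root 5 0.0075 (by norm_num) (by norm_num) (big 4 _ (by norm_num) (by norm_num))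
      push_cast at r2 r3 r5
      have l2 := Real.log_two_lt_d9
      rw [h4] at t
      nlinarith

lemma psi_le_mul {x : ℝ} (hx : 0 ≤ x) : ψ x ≤ 1.5 * x := by
  rw [psi_eq_psi_coe_floor]
  have := Nat.floor_le hx
  linarith [psi_natCast_le ⌊x⌋₊]

/-- A conditional lower bound for `ψ`: the two lists encode a linear combination of the functions
`log (N / n)!` whose Dirichlet coefficients are at most `A`, and at most `K` in any case. -/
lemma le_psi_of_certificate {P Q : List (ℕ × ℕ)} {A K K₀ D : ℕ} (hK₀ : 0 < K₀)
    (hA : ∀ m < K₀, modSum Q m ≤ A + modSum P m) (hK : ∀ m, modSum Q m ≤ K) (hAK : A ≤ K)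
    (hP : ∀ p ∈ P, 0 < p.1 ∧ p.1 ≤ D) (hQ : ∀ p ∈ Q, 0 < p.1 ∧ p.1 ≤ D)
    {N : ℕ} (hN : D ≤ N) (hN0 : 0 < N)
    (hPQ : weightedSum P (fun _ => 1) ≤ weightedSum Q (fun _ => 1)) :
    N * (weightedSum Q (fun n => Real.log n) - weightedSum P (fun n => Real.log n))
      - (Real.log N / 2 + 1) * (weightedSum Q (fun n => n) + weightedSum P (fun n => n) +
        (weightedSum Q (fun _ => 1) - weightedSum P (fun _ => 1)))
      - (K - A) * (1.5 * (N / K₀ : ℕ)) ≤ A * ψ N := by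
  have hAK' : (A : ℝ) ≤ K := by exact_mod_cast hAK
  have eq1 := sum_vonMangoldt_mul_modSum Q N
  have eq2 := sum_vonMangoldt_mul_modSum P N
  have hsum : ∑ d ∈ Icc 1 N, Λ d * (modSum Q (N / d) : ℝ) -
      ∑ d ∈ Icc 1 N, Λ d * (modSum P (N / d) : ℝ) ≤ A * ψ N + (K - A) * ψ (N / K₀ : ℕ) := by
    have e1 : ψ N = ∑ d ∈ Icc 1 N, Λ d := by
      rw [psi_eq_sum_Icc, Nat.floor_natCast, ← sum_subset (Icc_subset_Icc_left (zero_le_one' ℕ))]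
      intro d hd hd'
      have : d = 0 := by simp at hd hd'; omega
      simp [this]
    have e2 : ψ (N / K₀ : ℕ) = ∑ d ∈ Icc 1 N, if d ≤ N / K₀ then Λ d else 0 := by
      rw [psi_eq_sum_Icc, Nat.floor_natCast, ← sum_filter]
      symm
      refine sum_subset (fun d hd => ?_) fun d hd hd' => ?_
      · simp at hd ⊢; omega
      · have h1 := Nat.div_le_self N K₀
        have : d = 0 := by simp at hd hd'; omega
        simp [this]
    rw [e1, e2, mul_sum, mul_sum, ← sum_sub_distrib, ← sum_add_distrib]
    refine sum_le_sum fun d hd => ?_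
    have hd0 : 0 < d := (mem_Icc.1 hd).1
    have hL : 0 ≤ Λ d := ArithmeticFunction.vonMangoldt_nonneg
    rw [← mul_sub]
    split_ifs with hdk
    · have : (modSum Q (N / d) : ℝ) ≤ K := by exact_mod_cast hK _
      have h0 : (0 : ℝ) ≤ modSum P (N / d) := Nat.cast_nonneg _
      have : Λ d * ((modSum Q (N / d) : ℝ) - modSum P (N / d)) ≤ Λ d * K := by
        gcongr; linarith
      linarith
    · have hlt : N / d < K₀ := by
        rw [Nat.div_lt_iff_lt_mul hd0]
        have : N / K₀ < d := by omega
        rwa [Nat.div_lt_iff_lt_mul hK₀, mul_comm] at this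
      have : (modSum Q (N / d) : ℝ) ≤ A + modSum P (N / d) := by exact_mod_cast hA _ hlt
      have : Λ d * ((modSum Q (N / d) : ℝ) - modSum P (N / d)) ≤ Λ d * A := by
        gcongr; linarith
      linarith
  rw [eq1, eq2] at hsum
  set E := Real.log N / 2 + 1 with hE
  have hE0 : 0 ≤ E := by have := Real.log_natCast_nonneg N; positivity
  set G := Real.log (N ! : ℝ) - N * (Real.log N - 1) with hG
  have hG1 : |G| ≤ E := by
    have := abs_log_factorial_floor_sub_le (N := N) (n := 1) one_pos hN0
    simpa [hG, hE] using this
  have lowQ : weightedSum Q (fun n => (N : ℝ) * Real.log n + (G * 1 + -E * n)) ≤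
      weightedSum Q fun n => Real.log (N ! : ℝ) - n * Real.log ((N / n)! : ℝ) := by
    refine weightedSum_le fun p hp => ?_
    have := abs_le.1 (abs_log_factorial_floor_sub_le (hQ p hp).1 ((hQ p hp).2.trans hN))
    simp only [hG, ← hE] at this ⊢
    linarith [this.2]
  have upP : weightedSum P (fun n => Real.log (N ! : ℝ) - n * Real.log ((N / n)! : ℝ)) ≤
      weightedSum P (fun n => (N : ℝ) * Real.log n + (G * 1 + E * n)) := by
    refine weightedSum_le fun p hp => ?_
    have := abs_le.1 (abs_log_factorial_floor_sub_le (hP p hp).1 ((hP p hp).2.trans hN))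
    simp only [hG, ← hE] at this ⊢
    linarith [this.1]
  simp only [weightedSum_add, weightedSum_const_mul] at lowQ upP
  have hψ : (K - A : ℝ) * ψ (N / K₀ : ℕ) ≤ (K - A) * (1.5 * (N / K₀ : ℕ)) :=
    mul_le_mul_of_nonneg_left (psi_natCast_le _) (by linarith)
  have hGPQ : -E * (weightedSum Q (fun _ => 1) - weightedSum P (fun _ => 1)) ≤
      G * (weightedSum Q (fun _ => 1) - weightedSum P (fun _ => 1)) :=
    mul_le_mul_of_nonneg_right (abs_le.1 hG1).1 (by linarith)
  nlinarith

end PIntegerBound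

namespace PIntegerBound

open Finset Chebyshev
open scoped Nat ArithmeticFunction.vonMangoldt

/-- `10 ^ 12 * log (y + 1) / (y - 1)`, rounded down. -/
def logStepLower (y : ℕ) : ℕ :=
  2 * 10 ^ 12 / y + 2 * 10 ^ 12 / (3 * y ^ 3) +
    2 * 10 ^ 12 / (5 * y ^ 5) + 2 * 10 ^ 12 / (7 * y ^ 7)

/-- An upper bound for `10 ^ 12 * log (y + 1) / (y - 1)`. -/
def logStepUpper (y : ℕ) : ℕ :=
  logStepLower y + 2 * 10 ^ 12 / (y ^ 7 * (y ^ 2 - 1)) + 5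

lemma logStep_bounds {n : ℕ} (hn : 2 ≤ n) :
    (logStepLower (2 * n + 1) : ℝ) ≤ 10 ^ 12 * (Real.log (n + 1 : ℕ) - Real.log n) ∧
      10 ^ 12 * (Real.log (n + 1 : ℕ) - Real.log n) ≤ logStepUpper (2 * n + 1) := by
  set y := 2 * n + 1 with hy
  have hn0 : (0 : ℝ) < n := by exact_mod_cast (by omega : 0 < n)
  have hyR : (y : ℝ) = 2 * n + 1 := by simp [hy]
  have hy5 : 5 ≤ y := by omega
  have hy5' : (5 : ℝ) ≤ y := by exact_mod_cast hy5
  have hx0 : (0 : ℝ) ≤ 1 / y := by positivity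
  have hx1 : 1 / (y : ℝ) < 1 := by rw [div_lt_one (by linarith)]; linarith
  have hquot : (1 + 1 / (y : ℝ)) / (1 - 1 / y) = ((n + 1 : ℕ) : ℝ) / n := by
    rw [hyR]; push_cast
    have h1 : (2 * (n : ℝ) + 1) ≠ 0 := by positivity
    have h2 : 1 - 1 / (2 * (n : ℝ) + 1) ≠ 0 := by
      have : 1 - 1 / (2 * (n : ℝ) + 1) = 2 * n / (2 * n + 1) := by field_simp; ring
      rw [this]; positivity
    field_simp
    ring
  have hl : Real.log ((1 + 1 / (y : ℝ)) / (1 - 1 / y)) = Real.log (n + 1 : ℕ) - Real.log n := by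
    rw [hquot, Real.log_div (by positivity) hn0.ne']
  have lo := Real.sum_range_le_log_div hx0 hx1 4
  have up := Real.log_div_le_sum_range_add hx0 hx1 4
  rw [hl] at lo up
  simp only [sum_range_succ, sum_range_zero] at lo up
  norm_num at lo up
  have fl : ∀ d : ℕ, 0 < d → ((2 * 10 ^ 12 / d : ℕ) : ℝ) ≤ 2 * 10 ^ 12 / (d : ℝ) ∧
      2 * 10 ^ 12 / (d : ℝ) ≤ ((2 * 10 ^ 12 / d : ℕ) : ℝ) + 1 := fun d hd => by
    constructor
    · have := @Nat.cast_div_le ℝ _ _ _ (2 * 10 ^ 12) d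
      rw [Nat.cast_mul, Nat.cast_pow] at this; exact_mod_cast this
    · have hd' : (0 : ℝ) < d := by exact_mod_cast hd
      rw [div_le_iff₀ hd']
      have := (Nat.lt_div_mul_add (a := 2 * 10 ^ 12) hd).le
      have : ((2 * 10 ^ 12 : ℕ) : ℝ) ≤ ((2 * 10 ^ 12 / d * d + d : ℕ) : ℝ) := by exact_mod_cast this
      push_cast at this ⊢
      linarith
  have y2 : 1 ≤ y ^ 2 := Nat.one_le_pow _ _ (by omega)
  have y21 : 1 < y ^ 2 := Nat.one_lt_pow (by norm_num) (by omega)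
  have f1 := fl y (by omega)
  have f3 := fl (3 * y ^ 3) (by positivity)
  have f5 := fl (5 * y ^ 5) (by positivity)
  have f7 := fl (7 * y ^ 7) (by positivity)
  have f9 := fl (y ^ 7 * (y ^ 2 - 1)) (Nat.mul_pos (by positivity) (by omega))
  push_cast [Nat.cast_sub y2] at f1 f3 f5 f7 f9
  have hy0 : (y : ℝ) ≠ 0 := by linarith
  have hy21 : (y : ℝ) ^ 2 - 1 ≠ 0 := by nlinarith
  have e9 : 2 * 10 ^ 12 / ((y : ℝ) ^ 7 * (y ^ 2 - 1)) =
      2 * 10 ^ 12 * (((y : ℝ) ^ 9)⁻¹ / (1 - ((y : ℝ) ^ 2)⁻¹)) := by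
    have : 1 - ((y : ℝ) ^ 2)⁻¹ = (y ^ 2 - 1) / y ^ 2 := by field_simp
    rw [this]; field_simp
  have e1 : 2 * 10 ^ 12 / (y : ℝ) = 2 * 10 ^ 12 * (y : ℝ)⁻¹ := rfl
  have e3 : 2 * 10 ^ 12 / (3 * (y : ℝ) ^ 3) = 2 * 10 ^ 12 * (((y : ℝ) ^ 3)⁻¹ / 3) := by field_simp
  have e5 : 2 * 10 ^ 12 / (5 * (y : ℝ) ^ 5) = 2 * 10 ^ 12 * (((y : ℝ) ^ 5)⁻¹ / 5) := by field_simp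
  have e7 : 2 * 10 ^ 12 / (7 * (y : ℝ) ^ 7) = 2 * 10 ^ 12 * (((y : ℝ) ^ 7)⁻¹ / 7) := by field_simp
  rw [e1] at f1; rw [e3] at f3; rw [e5] at f5; rw [e7] at f7; rw [e9] at f9
  simp only [logStepUpper, logStepLower]
  push_cast
  constructor <;> linarith [f1.1, f3.1, f5.1, f7.1, f1.2, f3.2, f5.2, f7.2, f9.2]

/-- A lower bound for `10 ^ 12 * log n`. -/
def logLower : ℕ → ℕ
  | 0 => 0
  | 1 => 0
  | 2 => 693147180300
  | n + 3 => logLower (n + 2) + logStepLower (2 * n + 5)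

/-- An upper bound for `10 ^ 12 * log n`. -/
def logUpper : ℕ → ℕ
  | 0 => 0
  | 1 => 0
  | 2 => 693147180800
  | n + 3 => logUpper (n + 2) + logStepUpper (2 * n + 5)

lemma log_bounds : ∀ n : ℕ, (logLower n : ℝ) ≤ 10 ^ 12 * Real.log n ∧
    10 ^ 12 * Real.log n ≤ logUpper n
  | 0 => by simp [logLower, logUpper]
  | 1 => by simp [logLower, logUpper]
  | 2 => by
    have := Real.log_two_gt_d9
    have := Real.log_two_lt_d9
    constructor <;> · simp only [logLower, logUpper]; push_cast; linarith
  | n + 3 => by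
    have ih := log_bounds (n + 2)
    have h := logStep_bounds (n := n + 2) (by omega)
    rw [show 2 * (n + 2) + 1 = 2 * n + 5 by ring, show n + 2 + 1 = n + 3 by ring] at h
    simp only [logLower, logUpper, Nat.cast_add] at *
    constructor <;> linarith [h.1, h.2, ih.1, ih.2]

/-- `∑ b * F n` over the pairs `(n, b)` of a list, for integer-valued `F`. -/
def natWeightedSum (F : ℕ → ℕ) : List (ℕ × ℕ) → ℕ
  | [] => 0
  | (n, b) :: l => b * F n + natWeightedSum F l

lemma natWeightedSum_cast (F : ℕ → ℕ) (l : List (ℕ × ℕ)) :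
    (natWeightedSum F l : ℝ) = weightedSum l fun n => (F n : ℝ) := by
  induction l with
  | nil => simp [natWeightedSum, weightedSum]
  | cons p l ih => simp [natWeightedSum, weightedSum, ih]

lemma modSum_le (l : List (ℕ × ℕ)) (hl : ∀ p ∈ l, 0 < p.1) (m : ℕ) :
    modSum l m ≤ natWeightedSum (fun n => n - 1) l := by
  induction l with
  | nil => simp [modSum_nil, natWeightedSum]
  | cons p l ih =>
    obtain ⟨n, b⟩ := p
    simp only [List.forall_mem_cons] at hl
    have := Nat.mod_lt m hl.1
    simp only [modSum_cons, natWeightedSum]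
    exact add_le_add (Nat.mul_le_mul_left _ (by omega)) (ih hl.2)

/-- Evaluate a Boolean predicate after reducing its argument to a literal. -/
noncomputable def evalAt (f : ℕ → Bool) (a : ℕ) : Bool :=
  Nat.rec (motive := fun _ => Bool) (f 0) (fun n _ => f (Nat.succ n)) a

lemma evalAt_eq (f : ℕ → Bool) (a : ℕ) : evalAt f a = f a := by cases a <;> rfl

/-- Check a Boolean predicate on the `2 ^ d` integers from `a` on. -/
noncomputable def checkRange (f : ℕ → Bool) : ℕ → ℕ → Bool
  | 0, a => evalAt f a
  | d + 1, a => checkRange f d a && checkRange f d (a + 2 ^ d)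

lemma of_checkRange {f : ℕ → Bool} {d a : ℕ} (h : checkRange f d a = true) {m : ℕ} (ha : a ≤ m)
    (hm : m < a + 2 ^ d) : f m = true := by
  induction d generalizing a with
  | zero => rw [show m = a by omega, ← evalAt_eq f a]; exact h
  | succ d ih =>
    rw [checkRange, Bool.and_eq_true] at h
    rw [pow_succ] at hm
    rcases lt_or_ge m (a + 2 ^ d) with h' | h'
    · exact ih h.1 ha h'
    · exact ih h.2 h' (by omega)

/-- The list `P` of a certificate for `le_psi_of_certificate`, with weights scaled by `10 ^ 7`. -/
def posCoeffs : List (ℕ × ℕ) :=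
    [(6, 1666667), (10, 1000000), (14, 714286), (15, 666667), (21, 476190), (22, 274105), (26,
    384615), (32, 2883), (33, 303030), (34, 231192), (35, 166201), (36, 23895), (38, 135592), (39,
    54902), (44, 90220), (46, 70059), (49, 13201), (51, 104126), (54, 39013), (55, 69301), (56,
    30554), (57, 129495), (58, 76339), (62, 76871), (69, 10017), (74, 24404), (84, 8465), (85,
    37668), (86, 12904), (87, 34986), (88, 10552), (90, 15514), (95, 5390), (96, 9770), (100,
    6436), (101, 26324), (106, 16321), (111, 8493), (112, 10212), (117, 20860), (118, 6427), (119,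
    7124), (121, 2144), (122, 14058), (124, 4539), (125, 4857), (126, 26794), (129, 1899), (133,
    4285), (134, 4776), (135, 687), (144, 8444), (146, 970), (151, 11591), (152, 3438), (155,
    17908), (159, 14288), (160, 7051), (164, 2765), (166, 17210), (167, 18797), (171, 6327), (172,
    5697), (173, 4354), (179, 6276), (180, 19920), (181, 4797), (183, 13857), (184, 5426), (188,
    15193), (194, 3444), (196, 2077), (198, 949), (203, 15205), (205, 2175), (206, 3225), (209,
    997), (210, 40201), (212, 2720), (213, 3867), (215, 13455), (218, 3565), (220, 23445)]

/-- The list `Q` of a certificate for `le_psi_of_certificate`, with weights scaled by `10 ^ 7`. -/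
def negCoeffs : List (ℕ × ℕ) :=
    [(2, 5000000), (3, 3333333), (5, 2000000), (7, 1428571), (11, 909091), (13, 769231), (16,
    5767), (17, 582808), (18, 117039), (19, 415437), (23, 262187), (28, 89180), (29, 258723), (30,
    431036), (31, 228030), (37, 68199), (40, 23190), (42, 256422), (43, 179140), (45, 88680), (47,
    68123), (48, 11554), (52, 26941), (53, 75505), (59, 52913), (61, 55496), (64, 5656), (65,
    1225), (66, 121990), (67, 2100), (68, 412), (70, 49949), (72, 80450), (73, 40563), (76,
    17407), (77, 2058), (78, 48532), (79, 2521), (80, 27463), (92, 9772), (93, 3670), (97, 3034),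
    (98, 29474), (99, 16609), (102, 4038), (105, 40830), (107, 2335), (108, 15020), (109, 15475),
    (110, 66589), (114, 40705), (120, 2813), (128, 6274), (141, 5424), (148, 1522), (165, 7442),
    (175, 8743), (186, 7171), (201, 5228), (202, 5858)]

noncomputable def coeffCheck (m : ℕ) : Bool :=
  Nat.ble (modSum negCoeffs m) (Nat.add 10000410 (modSum posCoeffs m))

lemma coeffCheck_low : checkRange coeffCheck 12 0 = true := by decide +kernel

lemma coeffCheck_high : checkRange coeffCheck 11 4096 = true := by decide +kernel

lemma modSum_negCoeffs_le {m : ℕ} (hm : m < 6144) :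
    modSum negCoeffs m ≤ 10000410 + modSum posCoeffs m := by
  have key : coeffCheck m = true := by
    rcases lt_or_ge m 4096 with h | h
    · exact of_checkRange coeffCheck_low m.zero_le (by omega)
    · exact of_checkRange coeffCheck_high h (by omega)
  exact Nat.le_of_ble_eq_true key

lemma weightedSum_coeffs_log :
    9660900 + weightedSum posCoeffs (fun n => Real.log n) ≤
      weightedSum negCoeffs (fun n => Real.log n) := by
  have hQ : weightedSum negCoeffs (fun n => (logLower n : ℝ)) ≤
      weightedSum negCoeffs (fun n => 10 ^ 12 * Real.log n) :=
    weightedSum_le fun p _ => (log_bounds p.1).1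
  have hP : weightedSum posCoeffs (fun n => 10 ^ 12 * Real.log n) ≤
      weightedSum posCoeffs (fun n => (logUpper n : ℝ)) :=
    weightedSum_le fun p _ => (log_bounds p.1).2
  rw [weightedSum_const_mul, ← natWeightedSum_cast] at hQ hP
  have h : 9660900 * 10 ^ 12 + natWeightedSum logUpper posCoeffs ≤
    natWeightedSum logLower negCoeffs := by decide +kernel
  have h' : ((9660900 * 10 ^ 12 + natWeightedSum logUpper posCoeffs : ℕ) : ℝ) ≤
    (natWeightedSum logLower negCoeffs : ℝ) := by exact_mod_cast h
  push_cast at h'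
  linarith

lemma le_psi_natCast {N : ℕ} (hN : 220 ≤ N) :
    0.9613 * N - 23 * Real.log N - 46 ≤ ψ N := by
  have c1 := natWeightedSum_cast (fun _ => 1) posCoeffs
  have c2 := natWeightedSum_cast (fun _ => 1) negCoeffs
  have c3 := natWeightedSum_cast (fun n => n) posCoeffs
  have c4 := natWeightedSum_cast (fun n => n) negCoeffs
  have h12 : natWeightedSum (fun _ => 1) posCoeffs ≤ natWeightedSum (fun _ => 1) negCoeffs := by
    decide +kernel
  have h34 : natWeightedSum (fun n => n) negCoeffs + natWeightedSum (fun n => n) posCoeffs +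
      (natWeightedSum (fun _ => 1) negCoeffs - natWeightedSum (fun _ => 1) posCoeffs) ≤
      455300000 := by
    decide +kernel
  have h12' : (natWeightedSum (fun _ => 1) posCoeffs : ℝ) ≤
    natWeightedSum (fun _ => 1) negCoeffs := by exact_mod_cast h12
  have h34' : (natWeightedSum (fun n => n) negCoeffs : ℝ) + natWeightedSum (fun n => n) posCoeffs +
      (natWeightedSum (fun _ => 1) negCoeffs - natWeightedSum (fun _ => 1) posCoeffs) ≤
      455300000 := by
    rw [← Nat.cast_sub h12]; exact_mod_cast h34
  push_cast only [Nat.cast_one] at c1 c2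
  have h := le_psi_of_certificate (P := posCoeffs) (Q := negCoeffs) (A := 10000410)
    (K := 203500000) (K₀ := 6144) (D := 220) (by norm_num) (fun m hm => modSum_negCoeffs_le hm)
    (fun m => (modSum_le negCoeffs (by decide +kernel) m).trans (by decide +kernel))
    (by norm_num) (by decide +kernel) (by decide +kernel) hN (by omega)
    (by rw [← c1, ← c2]; exact h12')
  rw [← c1, ← c2, ← c3, ← c4] at h
  have hlog := Real.log_natCast_nonneg N
  have e1 := mul_le_mul_of_nonneg_left h34' (by linarith : 0 ≤ Real.log N / 2 + 1)
  have e2 : ((N / 6144 : ℕ) : ℝ) ≤ N / 6144 := by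
    have := @Nat.cast_div_le ℝ _ _ _ N 6144
    simpa using this
  have e3 : (N : ℝ) * 9660900 ≤ N * (weightedSum negCoeffs (fun n => Real.log n) -
      weightedSum posCoeffs fun n => Real.log n) := by
    gcongr; linarith [weightedSum_coeffs_log]
  have e4 : (0 : ℝ) ≤ N := Nat.cast_nonneg N
  push_cast at h
  linarith

end PIntegerBound

namespace PIntegerBound

open Finset Chebyshev

lemma log_le_of_logUpper_le {n u : ℕ} (h : logUpper n ≤ u) : Real.log n ≤ u / 10 ^ 12 := by
  have h1 : (logUpper n : ℝ) ≤ u := by exact_mod_cast h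
  have h2 := (log_bounds n).2
  rw [le_div_iff₀ (by norm_num)]
  linarith

lemma le_log_of_le_logLower {n u : ℕ} (h : u ≤ logLower n) : u / 10 ^ 12 ≤ Real.log n := by
  have h1 : (u : ℝ) ≤ logLower n := by exact_mod_cast h
  have h2 := (log_bounds n).1
  rw [div_le_iff₀ (by norm_num)]
  linarith

lemma log_ten_bounds : 2.30258 ≤ Real.log 10 ∧ Real.log 10 ≤ 2.30259 := by
  have h1 := le_log_of_le_logLower (n := 10) (u := 2302580000000) (by decide +kernel)
  have h2 := log_le_of_logUpper_le (n := 10) (u := 2302590000000) (by decide +kernel)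
  norm_num at h1 h2 ⊢
  exact ⟨by linarith, by linarith⟩

lemma log_three_bounds : 1.0986 ≤ Real.log 3 ∧ Real.log 3 ≤ 1.09862 := by
  have h1 := le_log_of_le_logLower (n := 3) (u := 1098600000000) (by decide +kernel)
  have h2 := log_le_of_logUpper_le (n := 3) (u := 1098620000000) (by decide +kernel)
  norm_num at h1 h2 ⊢
  exact ⟨by linarith, by linarith⟩

lemma rpow_inv_le_mul {x c X : ℝ} (m : ℕ) (hX : 0 < X) (hx : X ≤ x) (hc : 0 ≤ c)
    (h : 1 ≤ c ^ (m + 1) * X ^ m) : x ^ (((m + 1 : ℕ) : ℝ)⁻¹) ≤ c * x := by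
  have hx0 : 0 < x := hX.trans_le hx
  rw [Real.rpow_inv_le_iff_of_pos hx0.le (by positivity) (by positivity), Real.rpow_natCast]
  have : X ^ m ≤ x ^ m := by gcongr
  calc x = 1 * x := by ring
    _ ≤ (c ^ (m + 1) * X ^ m) * x := by gcongr
    _ ≤ (c ^ (m + 1) * x ^ m) * x := by gcongr
    _ = _ := by ring

lemma log_le_mul_of_le {x X l : ℝ} (hX : 0 < X) (hl : 1 ≤ l) (hlog : Real.log X ≤ l) (hx : X ≤ x) :
    Real.log x ≤ l / X * x := by
  have h := Real.log_le_sub_one_of_pos (div_pos (hX.trans_le hx) hX)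
  rw [Real.log_div (hX.trans_le hx).ne' hX.ne'] at h
  have h1 : 1 ≤ x / X := by rwa [one_le_div hX]
  have : l / X * x = l * (x / X) := by ring
  nlinarith

lemma mul_le_theta_of_le {X : ℕ} {l c₂ c₃ c₅ c : ℝ} (hX : 220 ≤ X) (hl1 : 1 ≤ l)
    (hl : Real.log X ≤ l) (h₂ : 0 ≤ c₂) (h₂' : 1 ≤ c₂ ^ 2 * (X : ℝ) ^ 1) (h₃ : 0 ≤ c₃)
    (h₃' : 1 ≤ c₃ ^ 3 * (X : ℝ) ^ 2) (h₅ : 0 ≤ c₅) (h₅' : 1 ≤ c₅ ^ 5 * (X : ℝ) ^ 4) (hc : 0 ≤ c)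
    (hc' : c * (1 + 1 / X) ≤ 0.9613 - 23 * (l / X) - 46 / X - 1.5 * (c₂ + c₃ + c₅))
    {x : ℝ} (hx : X ≤ x) : c * x ≤ θ x := by
  have hX0 : (0 : ℝ) < X := by exact_mod_cast (by omega : 0 < X)
  have hN : X ≤ ⌊x⌋₊ := Nat.le_floor hx
  have hxN := (Nat.lt_floor_add_one x).le
  rw [theta_eq_theta_coe_floor]
  set N := ⌊x⌋₊
  have hNX : (X : ℝ) ≤ N := by exact_mod_cast hN
  have a1 := le_psi_natCast (hX.trans hN)
  have a2 := psi_sub_theta_le_psi_add_psi_add_psi N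
  have b2 := rpow_inv_le_mul 1 hX0 hNX h₂ h₂'
  have b3 := rpow_inv_le_mul 2 hX0 hNX h₃ h₃'
  have b5 := rpow_inv_le_mul 4 hX0 hNX h₅ h₅'
  push_cast at b2 b3 b5
  norm_num at b2 b3 b5
  have d2 := psi_le_mul (x := (N : ℝ) ^ (2 : ℝ)⁻¹) (by positivity)
  have d3 := psi_le_mul (x := (N : ℝ) ^ (3 : ℝ)⁻¹) (by positivity)
  have d5 := psi_le_mul (x := (N : ℝ) ^ (5 : ℝ)⁻¹) (by positivity)
  norm_num at d2 d3 d5 a2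
  have e := log_le_mul_of_le hX0 hl1 hl hNX
  have f : (1 : ℝ) ≤ N / X := by rwa [one_le_div hX0]
  have g : c * x ≤ c * (1 + 1 / X) * N := by
    rw [mul_assoc]
    gcongr
    have : (1 + 1 / (X : ℝ)) * N = N + N / X := by ring
    linarith
  have h := mul_le_mul_of_nonneg_right hc' (hX0.le.trans hNX)
  have i : (46 : ℝ) ≤ 46 / X * N := by
    have : 46 / (X : ℝ) * N = 46 * (N / X) := by ring
    linarith
  linarith

lemma theta_ge_of_ten_pow_four_le {x : ℝ} (hx : 10 ^ 4 ≤ x) : 0.916 * x ≤ θ x := by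
  refine mul_le_theta_of_le (X := 10000) (l := 9.22) (c₂ := 0.01) (c₃ := 0.0021545)
    (c₅ := 0.00063097) (by norm_num) (by norm_num) ?_ (by norm_num) (by norm_num) (by norm_num)
    (by norm_num) (by norm_num) (by norm_num) (by norm_num) (by norm_num) (by norm_num; linarith)
  rw [show ((10000 : ℕ) : ℝ) = 10 ^ 4 by norm_num, Real.log_pow]
  norm_num; linarith [log_ten_bounds.2]

lemma theta_ge_of_two_mul_ten_pow_five_le {x : ℝ} (hx : 2 * 10 ^ 5 ≤ x) : 0.9556 * x ≤ θ x := by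
  refine mul_le_theta_of_le (X := 200000) (l := 12.21) (c₂ := 0.0022361) (c₃ := 0.00029241)
    (c₅ := 0.00005744) (by norm_num) (by norm_num) ?_ (by norm_num) (by norm_num) (by norm_num)
    (by norm_num) (by norm_num) (by norm_num) (by norm_num) (by norm_num) (by norm_num; linarith)
  rw [show ((200000 : ℕ) : ℝ) = 2 * 10 ^ 5 by norm_num, Real.log_mul (by norm_num) (by norm_num),
    Real.log_pow]
  norm_num; linarith [log_ten_bounds.2, Real.log_two_lt_d9]

lemma theta_ge_of_five_mul_ten_pow_six_le {x : ℝ} (hx : 5 * 10 ^ 6 ≤ x) : 0.9604 * x ≤ θ x := by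
  refine mul_le_theta_of_le (X := 5000000) (l := 15.43) (c₂ := 0.00044722) (c₃ := 0.0000342)
    (c₅ := 0.00000438) (by norm_num) (by norm_num) ?_ (by norm_num) (by norm_num) (by norm_num)
    (by norm_num) (by norm_num) (by norm_num) (by norm_num) (by norm_num) (by norm_num; linarith)
  rw [show ((5000000 : ℕ) : ℝ) = 10 ^ 7 / 2 by norm_num, Real.log_div (by norm_num) (by norm_num),
    Real.log_pow]
  norm_num; linarith [log_ten_bounds.2, Real.log_two_gt_d9]

end PIntegerBound

namespace PIntegerBound

open Finset Chebyshev MeasureTheory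
open scoped Nat.Prime

lemma theta_ge_of_five_mul_ten_pow_five_le {x : ℝ} (hx : 5 * 10 ^ 5 ≤ x) : 0.9582 * x ≤ θ x := by
  refine mul_le_theta_of_le (X := 500000) (l := 13.13) (c₂ := 0.00141422) (c₃ := 0.0001588)
    (c₅ := 0.00002761) (by norm_num) (by norm_num) ?_ (by norm_num) (by norm_num) (by norm_num)
    (by norm_num) (by norm_num) (by norm_num) (by norm_num) (by norm_num) (by norm_num; linarith)
  rw [show ((500000 : ℕ) : ℝ) = 10 ^ 6 / 2 by norm_num, Real.log_div (by norm_num) (by norm_num),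
    Real.log_pow]
  norm_num; linarith [log_ten_bounds.2, Real.log_two_gt_d9]

lemma intervalIntegrable_theta_div {a b : ℝ} (ha : 2 ≤ a) (hab : a ≤ b) :
    IntervalIntegrable (fun t => θ t / (t * Real.log t ^ 2)) volume a b := by
  rw [intervalIntegrable_iff_integrableOn_Icc_of_le hab]
  exact (integrableOn_theta_div_id_mul_log_sq b).mono_set (Set.Icc_subset_Icc_left ha)

lemma le_integral_theta_div {a b x c : ℝ} (ha : 2 ≤ a) (hab : a ≤ b) (hbx : b ≤ x)
    (h : ∀ t, a ≤ t → c * t ≤ θ t) :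
    c * (b - a) / Real.log x ^ 2 ≤ ∫ t in a..b, θ t / (t * Real.log t ^ 2) := by
  have hconst : c * (b - a) / Real.log x ^ 2 = ∫ _ in a..b, c / Real.log x ^ 2 := by
    rw [intervalIntegral.integral_const, smul_eq_mul]; ring
  rw [hconst]
  refine intervalIntegral.integral_mono_on hab (by simp) (intervalIntegrable_theta_div ha hab) ?_
  intro t ht
  have ht0 : 0 < t := by linarith [ht.1]
  have hlt : 0 < Real.log t := Real.log_pos (by linarith [ht.1])
  have hle : Real.log t ≤ Real.log x := Real.log_le_log ht0 (ht.2.trans hbx)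
  have hlx : 0 < Real.log x := hlt.trans_le hle
  rw [div_le_div_iff₀ (by positivity) (by positivity)]
  calc c * (t * Real.log t ^ 2) = (c * t) * Real.log t ^ 2 := by ring
    _ ≤ θ t * Real.log x ^ 2 := by
      have := h t ht.1
      gcongr

lemma theta_div_log_add_le_primeCounting {a b x c d : ℝ} (ha : 2 ≤ a) (hab : a ≤ b) (hbx : b ≤ x)
    (hca : ∀ t, a ≤ t → c * t ≤ θ t) (hdb : ∀ t, b ≤ t → d * t ≤ θ t) :
    θ x / Real.log x + (c * (b - a) + d * (x - b)) / Real.log x ^ 2 ≤ (π ⌊x⌋₊ : ℝ) := by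
  rw [primeCounting_eq_theta_div_log_add_integral (by linarith)]
  have i1 := intervalIntegrable_theta_div le_rfl ha
  have i2 := intervalIntegrable_theta_div ha hab
  have i3 := intervalIntegrable_theta_div (ha.trans hab) hbx
  rw [← intervalIntegral.integral_add_adjacent_intervals (i1.trans i2) i3,
    ← intervalIntegral.integral_add_adjacent_intervals i1 i2]
  have h1 := le_integral_theta_div ha hab hbx hca
  have h2 := le_integral_theta_div (ha.trans hab) hbx le_rfl hdb
  have h0 : 0 ≤ ∫ t in (2 : ℝ)..a, θ t / (t * Real.log t ^ 2) := by
    refine intervalIntegral.integral_nonneg ha fun t ht => ?_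
    have := theta_nonneg t
    have : 0 ≤ t := by linarith [ht.1]
    positivity
  rw [add_div]
  linarith

lemma primeCounting_ge {a b x c d e α : ℝ} (ha : 2 ≤ a) (hab : a ≤ b) (hbx : b ≤ x)
    (hca : ∀ t, a ≤ t → c * t ≤ θ t) (hdb : ∀ t, b ≤ t → d * t ≤ θ t)
    (hα : α * x ≤ θ x) (he : e * x ≤ c * (b - a) + d * (x - b)) :
    x * (α / Real.log x + e / Real.log x ^ 2) ≤ (π ⌊x⌋₊ : ℝ) := by
  refine le_trans ?_ (theta_div_log_add_le_primeCounting ha hab hbx hca hdb)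
  have hl : 0 < Real.log x := Real.log_pos (by linarith)
  rw [mul_add, mul_div_assoc', mul_div_assoc', mul_comm x α, mul_comm x e]
  gcongr

lemma primeCounting_ge_of_two_mul_ten_pow_five_le {x : ℝ} (hx : 2 * 10 ^ 5 ≤ x) :
    x * (0.9556 / Real.log x + 0.87 / Real.log x ^ 2) ≤ (π ⌊x⌋₊ : ℝ) :=
  primeCounting_ge (a := 10 ^ 4) (b := 10 ^ 4) (c := 0) (d := 0.916) (by norm_num) le_rfl
    (by linarith) (fun t _ => by simpa using theta_nonneg t)
    (fun t ht => theta_ge_of_ten_pow_four_le ht) (theta_ge_of_two_mul_ten_pow_five_le hx)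
    (by norm_num; linarith)

lemma primeCounting_ge_of_five_mul_ten_pow_five_le {x : ℝ} (hx : 5 * 10 ^ 5 ≤ x) :
    x * (0.9582 / Real.log x + 0.92 / Real.log x ^ 2) ≤ (π ⌊x⌋₊ : ℝ) :=
  primeCounting_ge (a := 10 ^ 4) (b := 2 * 10 ^ 5) (c := 0.916) (d := 0.9556) (by norm_num)
    (by norm_num) (by linarith)
    (fun t ht => theta_ge_of_ten_pow_four_le ht)
    (fun t ht => theta_ge_of_two_mul_ten_pow_five_le ht)
    (theta_ge_of_five_mul_ten_pow_five_le hx) (by norm_num; linarith)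

lemma primeCounting_ge_of_five_mul_ten_pow_six_le {x : ℝ} (hx : 5 * 10 ^ 6 ≤ x) :
    x * (0.9604 / Real.log x + 0.95 / Real.log x ^ 2) ≤ (π ⌊x⌋₊ : ℝ) :=
  primeCounting_ge (a := 10 ^ 4) (b := 2 * 10 ^ 5) (c := 0.916) (d := 0.9556) (by norm_num)
    (by norm_num) (by linarith)
    (fun t ht => theta_ge_of_ten_pow_four_le ht)
    (fun t ht => theta_ge_of_two_mul_ten_pow_five_le ht)
    (theta_ge_of_five_mul_ten_pow_six_le hx) (by norm_num; linarith)

end PIntegerBound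

namespace PIntegerBound

open Finset

/-- The number of integers coprime to `Q` among the `2 ^ d` integers `x, x + 2, x + 4, …`. -/
noncomputable def coprimeCount (Q : ℕ) : ℕ → ℕ → ℕ
  | 0, x => bif Nat.beq (Nat.gcd Q x) 1 then 1 else 0
  | d + 1, x => Nat.add (coprimeCount Q d x) (coprimeCount Q d (Nat.add x (2 ^ (d + 1))))

lemma coprimeCount_le {Q q : ℕ} (hQ : ∀ p < q, p.Prime → p ∣ Q) (d : ℕ) {x : ℕ} (hx : 2 ≤ x)
    (hxq : x + 2 ^ (d + 1) ≤ q ^ 2 + 1) :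
    Nat.count Nat.Prime x + coprimeCount Q d x ≤ Nat.count Nat.Prime (x + 2 ^ (d + 1)) := by
  induction d generalizing x with
  | zero =>
    have hmono : Nat.count Nat.Prime (x + 1) ≤ Nat.count Nat.Prime (x + 2 ^ (0 + 1)) :=
      Nat.count_monotone _ (by norm_num)
    refine le_trans ?_ hmono
    rw [Nat.count_succ]
    simp only [coprimeCount]
    cases h : Nat.beq (Nat.gcd Q x) 1 with
    | false => simp
    | true =>
      have hg : Nat.gcd Q x = 1 := Nat.eq_of_beq_eq_true h
      have hp : x.Prime := by
        by_contra hp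
        have h1 := Nat.minFac_sq_le_self (by omega) hp
        have h2 : x.minFac < q := lt_of_pow_lt_pow_left₀ 2 (by omega) (by omega)
        have h3 := Nat.minFac_prime (n := x) (by omega)
        have h4 := Nat.dvd_gcd (hQ _ h2 h3) x.minFac_dvd
        rw [hg] at h4
        exact h3.one_lt.ne' (Nat.dvd_one.1 h4)
      simp [hp]
  | succ d ih =>
    rw [pow_succ] at hxq
    have h1 := ih (x := x) hx (by omega)
    have h2 := ih (x := x + 2 ^ (d + 1)) (by omega) (by omega)
    have e : x + 2 ^ (d + 1 + 1) = x + 2 ^ (d + 1) + 2 ^ (d + 1) := by rw [pow_succ 2 (d + 1)]; ring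
    rw [e]
    have e2 : coprimeCount Q (d + 1) x =
      coprimeCount Q d x + coprimeCount Q d (x + 2 ^ (d + 1)) := rfl
    omega

/-- The sum of `n` consecutive blocks of `coprimeCount Q d` from `x` on. -/
noncomputable def coprimeBlocks (Q d x : ℕ) : ℕ → ℕ
  | 0 => 0
  | n + 1 => Nat.add (coprimeBlocks Q d x n)
      (coprimeCount Q d (Nat.add x (Nat.mul n (2 ^ (d + 1)))))

lemma coprimeBlocks_le {Q q : ℕ} (hQ : ∀ p < q, p.Prime → p ∣ Q) (d : ℕ) {x : ℕ} (hx : 2 ≤ x)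
    (n : ℕ) (hxq : x + n * 2 ^ (d + 1) ≤ q ^ 2 + 1) :
    Nat.count Nat.Prime x + coprimeBlocks Q d x n ≤ Nat.count Nat.Prime (x + n * 2 ^ (d + 1)) := by
  induction n with
  | zero => simp [coprimeBlocks]
  | succ n ih =>
    rw [add_mul, one_mul] at hxq
    have h1 := ih ((Nat.le_add_right _ _).trans (by rwa [← add_assoc] at hxq))
    have h2 := coprimeCount_le hQ d (x := x + n * 2 ^ (d + 1)) (by omega) (by omega)
    have e : x + (n + 1) * 2 ^ (d + 1) = x + n * 2 ^ (d + 1) + 2 ^ (d + 1) := by ring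
    have e2 : coprimeBlocks Q d x (n + 1) =
      coprimeBlocks Q d x n + coprimeCount Q d (x + n * 2 ^ (d + 1)) := rfl
    rw [e]
    omega

/-- An integer `A` with `exp (m - 1) < A * log A`. -/
def logThreshold : ℕ → ℕ
  | 5 => 31
  | 6 => 41
  | 7 => 99
  | 8 => 221
  | 9 => 485
  | 10 => 1179
  | 11 => 2961
  | _ => 6979

lemma exp_lt_logThreshold {m : ℕ} (h5 : 5 ≤ m) (h12 : m ≤ 12) :
    Real.exp (m - 1) < logThreshold m * Real.log (logThreshold m) := by
  have he := Real.exp_one_lt_d9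
  have l2 := Real.log_two_gt_d9
  have l3 := log_three_bounds.1
  have key : ∀ (j : ℕ) (A : ℝ), (2.7182818286 : ℝ) ^ j < A → Real.exp j < A := fun j A h => by
    refine lt_of_le_of_lt ?_ h
    rw [← Real.exp_one_pow]
    gcongr
  have e : Real.exp (m - 1) = Real.exp ((m - 1 : ℕ) : ℝ) := by rw [Nat.cast_sub (by omega)]; simp
  rw [e]
  apply key
  have a1 := le_log_of_le_logLower (n := 31) (u := 3400000000000) (by decide +kernel)
  have a2 := le_log_of_le_logLower (n := 41) (u := 3700000000000) (by decide +kernel)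
  have a3 := le_log_of_le_logLower (n := 99) (u := 4500000000000) (by decide +kernel)
  have a4 := le_log_of_le_logLower (n := 221) (u := 5300000000000) (by decide +kernel)
  have a5 := le_log_of_le_logLower (n := 485) (u := 6180000000000) (by decide +kernel)
  have a6 : 10 * Real.log 2 ≤ Real.log 1179 := by
    rw [← Nat.cast_ofNat, ← Real.log_pow]; exact Real.log_le_log (by norm_num) (by norm_num)
  have a7 : 7 * Real.log 3 ≤ Real.log 2961 := by
    rw [← Nat.cast_ofNat, ← Real.log_pow]; exact Real.log_le_log (by norm_num) (by norm_num)
  have a8 : 8 * Real.log 3 ≤ Real.log 6979 := by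
    rw [← Nat.cast_ofNat, ← Real.log_pow]; exact Real.log_le_log (by norm_num) (by norm_num)
  norm_num at a1 a2 a3 a4 a5
  interval_cases m <;> norm_num [logThreshold] <;> linarith

/-- Check that for every entry `(d, n, m, b)` of the list, with `a` the predecessor's `b + 1`,
there are more than `b` primes up to `a * m`. -/
noncomputable def tableCheck (Q q : ℕ) : List (ℕ × ℕ × ℕ × ℕ) → ℕ → ℕ → ℕ → Bool
  | [], _, _, _ => true
  | (d, n, m, b) :: l, a, x, c =>
    evalAt (fun c' => evalAt (fun x' => Nat.ble (Nat.succ b) c' &&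
      (Nat.ble x' (Nat.succ (Nat.mul a m)) &&
      (Nat.ble x' (Nat.succ (q ^ 2)) && (Nat.ble 5 m && (Nat.ble m 12 &&
      (Nat.ble (logThreshold m) a &&
        tableCheck Q q l (Nat.succ b) x' c')))))) (Nat.add x (Nat.mul n (2 ^ (d + 1)))))
      (Nat.add c (coprimeBlocks Q d x n))

/-- The end of the last interval of a table. -/
def tableEnd : List (ℕ × ℕ × ℕ × ℕ) → ℕ → ℕ
  | [], a => a
  | (_, _, _, b) :: l, _ => tableEnd l (b + 1)

lemma of_tableCheck {Q q : ℕ} (hQ : ∀ p < q, p.Prime → p ∣ Q) (l : List (ℕ × ℕ × ℕ × ℕ))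
    {a x c : ℕ} (hx : 2 ≤ x) (hc : c ≤ Nat.count Nat.Prime x)
    (h : tableCheck Q q l a x c = true) {k : ℕ} (hak : a ≤ k) (hk : k < tableEnd l a) :
    ∃ a' ≤ k, ∃ m, 5 ≤ m ∧ m ≤ 12 ∧ logThreshold m ≤ a' ∧ k < Nat.primeCounting (a' * m) := by
  induction l generalizing a x c with
  | nil => simp [tableEnd] at hk; omega
  | cons e l ih =>
    obtain ⟨d, n, m, b⟩ := e
    simp only [tableCheck, evalAt_eq, Bool.and_eq_true] at h
    obtain ⟨h1, h2, h3, h4, h5, h6, h7⟩ := h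
    have h1 : b + 1 ≤ c + coprimeBlocks Q d x n := Nat.le_of_ble_eq_true h1
    have h2 : x + n * 2 ^ (d + 1) ≤ a * m + 1 := Nat.le_of_ble_eq_true h2
    have h3 : x + n * 2 ^ (d + 1) ≤ q ^ 2 + 1 := Nat.le_of_ble_eq_true h3
    have hb := coprimeBlocks_le hQ d hx n h3
    rcases le_or_gt k b with hkb | hkb
    · refine ⟨a, hak, m, Nat.le_of_ble_eq_true h4, Nat.le_of_ble_eq_true h5,
        Nat.le_of_ble_eq_true h6, ?_⟩
      have : Nat.count Nat.Prime (x + n * 2 ^ (d + 1)) ≤ Nat.primeCounting (a * m) :=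
        Nat.count_monotone _ h2
      omega
    · exact ih (a := b + 1) (x := x + n * 2 ^ (d + 1)) (c := c + coprimeBlocks Q d x n)
        (by omega) (by omega) h7 (by omega) hk

def primorial456 : ℕ :=
  47952908052796135760256600170199578387740533448517890811411728517171138658867337095151452769077564443190074989606933241597341551376625294861617115261811011811910212652094403655944384810

lemma dvd_primorial456 (p : ℕ) (hp : p < 457) (hpp : p.Prime) : p ∣ primorial456 := by
  have h : ∀ n < 457, 2 ≤ n → Nat.gcd n primorial456 ≠ 1 := by decide +kernel
  by_contra hd
  exact h p hp hpp.two_le ((Nat.Prime.coprime_iff_not_dvd hpp).2 hd)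

lemma dvd_primorial22 (p : ℕ) (hp : p < 23) (hpp : p.Prime) : p ∣ 9699690 := by
  interval_cases p <;> first | (exfalso; revert hpp; norm_num; done) | norm_num

def lowTable : List (ℕ × ℕ × ℕ × ℕ) :=
    [(0, 66, 5, 35), (0, 13, 5, 40), (0, 33, 6, 52), (0, 36, 6, 65), (0, 39, 6, 76), (0, 33,
    6, 88)]

def highTable : List (ℕ × ℕ × ℕ × ℕ) :=
    [(0, 39, 6, 98), (0, 79, 7, 124), (0, 91, 7, 149), (2, 22, 7, 175), (2, 22, 7, 199), (2,
    21, 7, 220), (2, 46, 8, 273), (2, 53, 8, 326), (2, 53, 8, 378), (2, 52, 8, 433), (2, 55,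
    8, 484), (2, 112, 9, 594), (2, 124, 9, 707), (2, 127, 9, 829), (2, 137, 9, 944), (2,
    129, 9, 1058), (5, 16, 9, 1178), (5, 35, 10, 1408), (5, 36, 10, 1657), (5, 39, 10,
    1916), (5, 40, 10, 2169), (5, 40, 10, 2432), (5, 41, 10, 2699), (5, 42, 10, 2960), (5,
    87, 11, 3492), (5, 91, 11, 4050), (5, 96, 11, 4626), (5, 99, 11, 5208), (5, 100, 11,
    5806), (5, 103, 11, 6404), (5, 103, 11, 6978), (5, 207, 12, 8166), (5, 223, 12, 9415),
    (5, 234, 12, 10696), (5, 240, 12, 12009), (5, 247, 12, 13349), (5, 251, 12, 14699), (5,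
    253, 12, 16027), (5, 249, 12, 17351)]

lemma tableCheck_lowTable : tableCheck 9699690 23 lowTable 31 23 8 = true := by decide +kernel

lemma tableCheck_highTable : tableCheck primorial456 457 highTable 89 457 87 = true := by
  decide +kernel

lemma eight_le_count_prime : 8 ≤ Nat.count Nat.Prime 23 := by decide +kernel

lemma eightySeven_le_count_prime : 87 ≤ Nat.count Nat.Prime 457 := by
  have h := coprimeBlocks_le dvd_primorial22 0 (x := 23) (by norm_num) 217 (by norm_num)
  have h' : 79 ≤ coprimeBlocks 9699690 0 23 217 := by decide +kernel
  have := eight_le_count_prime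
  norm_num at h
  omega

lemma not_log_le_of_le {k t : ℕ} (hk : 31 ≤ k) (hk' : k ≤ 17351)
    (hπ : Nat.primeCounting (t * k) ≤ k) : (t : ℝ) < Real.log (k * Real.log k) := by
  by_contra! ht
  obtain ⟨a, hak, m, h5, h12, hth, hlt⟩ : ∃ a ≤ k, ∃ m, 5 ≤ m ∧ m ≤ 12 ∧ logThreshold m ≤ a ∧
      k < Nat.primeCounting (a * m) := by
    rcases lt_or_ge k 89 with h | h
    · exact of_tableCheck dvd_primorial22 lowTable (by norm_num) eight_le_count_prime
        tableCheck_lowTable hk (h.trans_le (by decide))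
    · exact of_tableCheck dvd_primorial456 highTable (by norm_num) eightySeven_le_count_prime
        tableCheck_highTable h (lt_of_le_of_lt hk' (by decide))
  have h1 := exp_lt_logThreshold h5 h12
  have hA : 31 ≤ logThreshold m := by interval_cases m <;> decide
  have hA' : (31 : ℝ) ≤ logThreshold m := by exact_mod_cast hA
  have hAk : (logThreshold m : ℝ) ≤ k := by exact_mod_cast hth.trans hak
  have h2 : (logThreshold m : ℝ) * Real.log (logThreshold m) ≤ k * Real.log k := by
    have := Real.log_nonneg (by linarith : (1 : ℝ) ≤ logThreshold m)
    gcongr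
  have h3 : (m : ℝ) - 1 < Real.log (k * Real.log k) :=
    (Real.lt_log_iff_exp_lt ((Real.exp_pos _).trans (h1.trans_le h2))).2 (h1.trans_le h2)
  have h4 : m ≤ t := by
    have : (m : ℝ) < t + 1 := by linarith
    have : m < t + 1 := by exact_mod_cast this
    omega
  have h6 : Nat.primeCounting (a * m) ≤ Nat.primeCounting (t * k) :=
    Nat.monotone_primeCounting (by rw [mul_comm]; exact Nat.mul_le_mul h4 hak)
  omega

end PIntegerBound

namespace PIntegerBound

lemma not_log_le_of_primeCounting_ge {c c₂ X l₀ l₁ Λ γ : ℝ}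
    (hπ : ∀ x : ℝ, X ≤ x → x * (c / Real.log x + c₂ / Real.log x ^ 2) ≤
      (Nat.primeCounting ⌊x⌋₊ : ℝ))
    (hc : c ≤ 1) (hl₀ : 9 ≤ l₀) (hΛ : Real.log l₁ ≤ Λ) (hγ : Real.log l₀ ≤ γ * l₀)
    (hnum : (1 - c) * (l₁ + Λ) + (2 - c) * γ + γ ^ 2 / 10 < c₂)
    {k t : ℕ} (hk₀ : l₀ ≤ Real.log k) (hk₁ : Real.log k ≤ l₁)
    (hX : X ≤ k * (Real.log k + Real.log (Real.log k)))
    (hk : Nat.primeCounting (t * k) ≤ k) : (t : ℝ) < Real.log (k * Real.log k) := by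
  by_contra! ht
  set l := Real.log k with hl
  have hk0 : (0 : ℝ) < k := by
    rcases Nat.eq_zero_or_pos k with h | h
    · simp [h] at hl; linarith
    · exact_mod_cast h
  have hl0 : 0 < l := by linarith
  rw [Real.log_mul hk0.ne' hl0.ne', ← hl] at ht
  set L := l + Real.log l with hL
  have hlogl : 1 ≤ Real.log l := by
    rw [Real.le_log_iff_exp_le hl0]
    linarith [Real.exp_one_lt_d9]
  have hL10 : 10 ≤ L := by linarith
  have hL0 : 0 < L := by linarith
  have h1 := hπ _ hX
  have h2 : Nat.primeCounting ⌊(k : ℝ) * L⌋₊ ≤ k := by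
    refine le_trans (Nat.monotone_primeCounting ?_) hk
    have : (k : ℝ) * L ≤ (t * k : ℕ) := by push_cast; rw [mul_comm]; gcongr
    exact_mod_cast (Nat.floor_le (by positivity)).trans this
  have h2' : (Nat.primeCounting ⌊(k : ℝ) * L⌋₊ : ℝ) ≤ k := by exact_mod_cast h2
  set g := Real.log (L / l) with hg
  have hlx : Real.log (k * L) = L + g := by
    rw [Real.log_mul hk0.ne' hL0.ne', hg, Real.log_div hL0.ne' hl0.ne', ← hl, hL]; ring
  have hg0 : 0 ≤ g := Real.log_nonneg (by rw [one_le_div hl0]; linarith)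
  have hg1 : g ≤ Real.log l / l := by
    have := Real.log_le_sub_one_of_pos (div_pos hL0 hl0)
    have e : L / l - 1 = Real.log l / l := by rw [hL]; field_simp; ring
    linarith
  have he : Real.exp 1 ≤ l₀ := by linarith [Real.exp_one_lt_d9]
  have hg2 : g ≤ γ := by
    refine hg1.trans ((Real.log_div_self_antitoneOn he (he.trans hk₀) hk₀).trans ?_)
    rwa [div_le_iff₀ (by linarith)]
  have hL1 : L ≤ l₁ + Λ := by
    have := Real.log_le_log hl0 hk₁
    linarith
  rw [hlx] at h1
  have hs : 0 < L + g := by linarith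
  have h3 : L * (c * (L + g) + c₂) ≤ (L + g) ^ 2 := by
    have h4 : k * L * (c / (L + g) + c₂ / (L + g) ^ 2) ≤ k := h1.trans h2'
    have e : (k : ℝ) * L * (c / (L + g) + c₂ / (L + g) ^ 2) =
        k * (L * (c * (L + g) + c₂) / (L + g) ^ 2) := by field_simp
    rw [e] at h4
    have h5 : L * (c * (L + g) + c₂) / (L + g) ^ 2 ≤ 1 := by
      by_contra! h
      nlinarith
    rwa [div_le_one (by positivity)] at h5
  have h6 : L * c₂ ≤ L * ((1 - c) * L + (2 - c) * g + g ^ 2 / 10) := by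
    have : g ^ 2 ≤ L * (g ^ 2 / 10) := by nlinarith [sq_nonneg g]
    nlinarith
  have h7 : c₂ ≤ (1 - c) * L + (2 - c) * g + g ^ 2 / 10 := le_of_mul_le_mul_left h6 hL0
  have h8 : (1 - c) * L ≤ (1 - c) * (l₁ + Λ) := mul_le_mul_of_nonneg_left hL1 (by linarith)
  have h9 : (2 - c) * g ≤ (2 - c) * γ := mul_le_mul_of_nonneg_left hg2 (by linarith)
  have h10 : g ^ 2 ≤ γ ^ 2 := by gcongr
  linarith

lemma not_log_le_of_log_le {k t : ℕ} (hk : 31 ≤ k) (hk' : Real.log k ≤ 15.5)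
    (hπ : Nat.primeCounting (t * k) ≤ k) : (t : ℝ) < Real.log (k * Real.log k) := by
  rcases le_or_gt k 17351 with h | h
  · exact not_log_le_of_le hk h hπ
  have l2 := Real.log_two_gt_d9
  have l2' := Real.log_two_lt_d9
  have l3 := log_three_bounds
  have hkR : (17352 : ℝ) ≤ k := by exact_mod_cast h
  have hk0 : (0 : ℝ) < k := by linarith
  have hlk : 9.6 ≤ Real.log k := by
    have h1 : 14 * Real.log 2 ≤ Real.log k := by
      rw [← Nat.cast_ofNat, ← Real.log_pow]
      exact Real.log_le_log (by norm_num) (by norm_num; linarith)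
    linarith
  have l11 := log_le_of_logUpper_le (n := 11) (u := 2400000000000) (by decide +kernel)
  have l11' := le_log_of_le_logLower (n := 11) (u := 2300000000000) (by decide +kernel)
  have l31 := log_le_of_logUpper_le (n := 31) (u := 3434000000000) (by decide +kernel)
  have l9 : Real.log 9 = 2 * Real.log 3 := by
    rw [show (9 : ℝ) = 3 ^ 2 by norm_num, Real.log_pow]; norm_num
  have l27 : Real.log (27 / 2) = 3 * Real.log 3 - Real.log 2 := by
    rw [Real.log_div (by norm_num) (by norm_num), show (27 : ℝ) = 3 ^ 3 by norm_num, Real.log_pow]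
    norm_num
  have l31' : Real.log (31 / 2) = Real.log 31 - Real.log 2 :=
    Real.log_div (by norm_num) (by norm_num)
  norm_num at l11 l11' l31
  have kexp : ∀ (j : ℕ) (A : ℝ), A ≤ 2.718 ^ j → (j : ℝ) ≤ Real.log k → A ≤ k := by
    intro j A hA hj
    rw [Real.le_log_iff_exp_le hk0, ← Real.exp_one_pow] at hj
    refine hA.trans (le_trans ?_ hj)
    have := Real.exp_one_gt_d9
    gcongr
    linarith
  have hll : Real.log 9 ≤ Real.log (Real.log k) := Real.log_le_log (by norm_num) (by linarith)
  rcases le_or_gt (Real.log k) 11 with h1 | h1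
  · refine not_log_le_of_primeCounting_ge (l₀ := 9) (l₁ := 11) (Λ := 2.4) (γ := 0.2442)
      (fun x hx => primeCounting_ge_of_two_mul_ten_pow_five_le hx) (by norm_num) (by norm_num)
      (by linarith) (by linarith) (by norm_num) (by linarith) h1 ?_ hπ
    nlinarith
  rcases le_or_gt (Real.log k) (27 / 2) with h2 | h2
  · have := kexp 11 59000 (by norm_num) (by norm_num; linarith)
    refine not_log_le_of_primeCounting_ge (l₀ := 11) (l₁ := 27 / 2) (Λ := 2.605) (γ := 0.2182)
      (fun x hx => primeCounting_ge_of_five_mul_ten_pow_five_le hx) (by norm_num) (by norm_num)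
      (by linarith) (by linarith) (by norm_num) (by linarith) h2 ?_ hπ
    nlinarith
  · have := kexp 13 440000 (by norm_num) (by norm_num; linarith)
    refine not_log_le_of_primeCounting_ge (l₀ := 27 / 2) (l₁ := 31 / 2) (Λ := 2.741) (γ := 0.1929)
      (fun x hx => primeCounting_ge_of_five_mul_ten_pow_six_le hx) (by norm_num) (by norm_num)
      (by linarith) (by linarith) (by norm_num) h2.le (by linarith) ?_ hπ
    nlinarith

end PIntegerBound

namespace PIntegerBound

open Finset

lemma totient_add_card_primeFactors_le {k : ℕ} (hk : 1 < k) :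
    k.totient + k.primeFactors.card ≤ k := by
  classical
  rw [Nat.totient_eq_card_coprime, ← card_union_of_disjoint]
  · refine (card_le_card (t := Icc 1 k) ?_).trans (by simp)
    intro n hn
    simp only [mem_union, mem_filter, mem_range, Nat.mem_primeFactors] at hn
    rw [mem_Icc]
    rcases hn with ⟨h1, h2⟩ | ⟨h1, h2, -⟩
    · rcases Nat.eq_zero_or_pos n with h | h
      · subst h; simp at h2; omega
      · omega
    · exact ⟨h1.one_lt.le, Nat.le_of_dvd (by omega) h2⟩
  · rw [Finset.disjoint_left]
    intro n hn hn'
    simp only [mem_filter, mem_range, Nat.mem_primeFactors] at hn hn'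
    have := Nat.dvd_gcd hn'.2.1 (dvd_refl n)
    rw [hn.2] at this
    exact hn'.1.one_lt.ne' (Nat.dvd_one.1 this)

lemma totient_eq_mul_prod (k : ℕ) :
    (k.totient : ℝ) = k * ∏ p ∈ k.primeFactors, (1 - (p : ℝ)⁻¹) := by
  have h := congrArg (fun q : ℚ => (q : ℝ)) (Nat.totient_eq_mul_prod_factors k)
  push_cast at h
  exact h

lemma totient_div_le_one_sub_inv {k p : ℕ} (hk : k ≠ 0) (hp : p ∈ k.primeFactors) :
    (k.totient : ℝ) / k ≤ 1 - 1 / p := by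
  have h' := totient_eq_mul_prod k
  have hk0 : (k : ℝ) ≠ 0 := by exact_mod_cast hk
  rw [h', mul_div_cancel_left₀ _ hk0, one_div, ← mul_prod_erase _ _ hp]
  have hb : ∀ q ∈ k.primeFactors, 0 ≤ 1 - (q : ℝ)⁻¹ ∧ 1 - (q : ℝ)⁻¹ ≤ 1 := fun q hq => by
    have : (1 : ℝ) ≤ q := by exact_mod_cast (Nat.prime_of_mem_primeFactors hq).one_lt.le
    have h1 := inv_le_one_of_one_le₀ this
    have h2 : 0 ≤ (q : ℝ)⁻¹ := by positivity
    constructor <;> linarith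
  refine mul_le_of_le_one_right (hb p hp).1 (prod_le_one ?_ ?_)
  · exact fun q hq => (hb q (mem_of_mem_erase hq)).1
  · exact fun q hq => (hb q (mem_of_mem_erase hq)).2

lemma totient_div_mul_exp_le {k : ℕ} (hk : k ≠ 0) :
    (k.totient : ℝ) / k * Real.exp (∑ p ∈ k.primeFactors, (1 / p : ℝ)) ≤ 1 := by
  have h' := totient_eq_mul_prod k
  have hk0 : (k : ℝ) ≠ 0 := by exact_mod_cast hk
  rw [h', mul_div_cancel_left₀ _ hk0, Real.exp_sum, ← prod_mul_distrib]
  have hb : ∀ q ∈ k.primeFactors, 0 ≤ 1 - (q : ℝ)⁻¹ := fun q hq => by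
    have : (1 : ℝ) ≤ q := by exact_mod_cast (Nat.prime_of_mem_primeFactors hq).one_lt.le
    have h1 := inv_le_one_of_one_le₀ this
    linarith
  refine prod_le_one (fun q hq => mul_nonneg (hb q hq) (Real.exp_pos _).le) fun q hq => ?_
  have := Real.add_one_le_exp (-(1 / q : ℝ))
  calc (1 - (q : ℝ)⁻¹) * Real.exp (1 / q) ≤ Real.exp (-(1 / q)) * Real.exp (1 / q) := by
        gcongr; rw [one_div] at this ⊢; linarith
    _ = 1 := by rw [← Real.exp_add]; simp

/-- Consequences of `log (k log k) ≤ t` for large `k` via the lower bound for `π (t k)`. -/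
structure Extremal (k t : ℕ) : Prop where
  lt_log : 15.5 < Real.log k
  le : 19 ≤ t
  log_le : Real.log k ≤ t
  le_log : 0.9604 * t + 0.93 - Real.log t ≤ Real.log k
  le_of_dvd : ∀ p, p.Prime → p ∣ k → 29 ≤ p
  sum_le : ∑ p ∈ k.primeFactors, (1 / p : ℝ) ≤ 0.0408
  le_totient : (0.9603 : ℝ) * k ≤ k.totient

lemma extremal {k t : ℕ} (hl : 15.5 < Real.log k) (ht : Real.log (k * Real.log k) ≤ t)
    (hπ : Nat.primeCounting (t * k) ≤ k.totient + k.primeFactors.card) : Extremal k t := by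
  set l := Real.log k with hldef
  have hk0 : (0 : ℝ) < k := by
    rcases Nat.eq_zero_or_pos k with h | h
    · simp [h] at hldef; linarith
    · exact_mod_cast h
  have hk0' : k ≠ 0 := by rintro rfl; simp at hk0
  have hkbig : 3000000 ≤ (k : ℝ) := by
    have : (15 : ℕ) ≤ Real.log k := by push_cast; linarith
    rw [Real.le_log_iff_exp_le hk0, ← Real.exp_one_pow] at this
    refine le_trans ?_ this
    have := Real.exp_one_gt_d9
    calc (3000000 : ℝ) ≤ 2.718 ^ 15 := by norm_num
      _ ≤ _ := by gcongr; linarith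
  have hl0 : 0 < l := by linarith
  rw [Real.log_mul hk0.ne' hl0.ne', ← hldef] at ht
  set L := l + Real.log l with hL
  have l2 := Real.log_two_gt_d9
  have l2' := Real.log_two_lt_d9
  have l31 := log_le_of_logUpper_le (n := 31) (u := 3434000000000) (by decide +kernel)
  have l31_le := le_log_of_le_logLower (n := 31) (u := 3433900000000) (by decide +kernel)
  norm_num at l31 l31_le
  have l31' : Real.log (31 / 2) = Real.log 31 - Real.log 2 :=
    Real.log_div (by norm_num) (by norm_num)
  have hlogl : 2.74 ≤ Real.log l := by
    have := Real.log_le_log (by norm_num) (show (31 / 2 : ℝ) ≤ l by linarith)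
    linarith
  have hL0 : 0 < L := by linarith
  have ht18 : (18 : ℝ) < t := by linarith
  have ht19 : 19 ≤ t := by exact_mod_cast ht18
  have ht0 : (0 : ℝ) < t := by linarith
  set g := Real.log (L / l) with hg
  have hg2 : g ≤ 0.18 := by
    have h1 := Real.log_le_sub_one_of_pos (div_pos hL0 hl0)
    have e : L / l - 1 = Real.log l / l := by rw [hL]; field_simp; ring
    have h2 : Real.log l / l ≤ Real.log (31 / 2) / (31 / 2) :=
      Real.log_div_self_antitoneOn (show Real.exp 1 ≤ _ by linarith [Real.exp_one_lt_d9])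
        (show Real.exp 1 ≤ _ by linarith [Real.exp_one_lt_d9]) (by linarith)
    have h3 : Real.log (31 / 2) / (31 / 2) ≤ 0.18 := by
      rw [div_le_iff₀ (by norm_num)]; linarith
    linarith
  set x := Real.log (t * k : ℝ) with hx
  have hxe : x = Real.log t + l := Real.log_mul ht0.ne' hk0.ne'
  have hlogt : Real.log t ≤ t - l + g := by
    have h1 := Real.log_le_sub_one_of_pos (div_pos ht0 hL0)
    rw [Real.log_div ht0.ne' hL0.ne'] at h1
    have h2 : Real.log L = Real.log l + g := by rw [hg, Real.log_div hL0.ne' hl0.ne']; ring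
    have h3 : (t : ℝ) / L - 1 ≤ t - L := by
      rw [sub_le_iff_le_add, div_le_iff₀ hL0]
      nlinarith
    linarith
  have hxt : x ≤ t + 0.18 := by linarith
  have hx0 : 0 < x := by
    have := Real.log_nonneg (by linarith : (1 : ℝ) ≤ t)
    linarith
  have h1 := primeCounting_ge_of_five_mul_ten_pow_six_le (x := (t * k : ℕ))
    (by push_cast; nlinarith)
  rw [Nat.floor_natCast] at h1
  set T : ℝ := ((k.totient + k.primeFactors.card : ℕ) : ℝ) with hT
  have h2 : (Nat.primeCounting (t * k) : ℝ) ≤ T := by rw [hT]; exact_mod_cast hπ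
  push_cast only [Nat.cast_mul] at h1
  rw [← hx] at h1
  have h3 : t * (0.9604 * x + 0.95) ≤ T / k * x ^ 2 := by
    have e : (t : ℝ) * k * (0.9604 / x + 0.95 / x ^ 2) = k * (t * (0.9604 * x + 0.95)) / x ^ 2 := by
      field_simp
    rw [e, div_le_iff₀ (by positivity)] at h1
    have h4 : (k : ℝ) * (t * (0.9604 * x + 0.95)) ≤ k * (T / k * x ^ 2) := by
      have e2 : (k : ℝ) * (T / k * x ^ 2) = T * x ^ 2 := by field_simp
      rw [e2]
      exact h1.trans (by gcongr)
    exact le_of_mul_le_mul_left h4 hk0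
  have hT1 : T / k ≤ 1 := by
    rw [div_le_one hk0, hT]
    exact_mod_cast totient_add_card_primeFactors_le (by
      have : (1 : ℝ) < k := by linarith
      exact_mod_cast this)
  have hx1 : 0.9604 * t + 0.93 ≤ x := by
    have h4 : x * (0.9604 * t + 0.93) ≤ x * x := by
      have : T / k * x ^ 2 ≤ 1 * x ^ 2 := by gcongr
      nlinarith
    exact le_of_mul_le_mul_left h4 hx0
  have hF : 0.9604 ≤ T / k := by
    by_contra! hF
    have h4 : T / k * x ^ 2 ≤ 0.9604 * x ^ 2 := by gcongr
    nlinarith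
  have hω : (k.primeFactors.card : ℝ) ≤ 0.0001 * k := by
    have h4 : 2 ^ k.primeFactors.card ≤ k := by
      calc 2 ^ k.primeFactors.card ≤ ∏ p ∈ k.primeFactors, p :=
            Finset.pow_card_le_prod _ _ _ fun p hp => (Nat.prime_of_mem_primeFactors hp).two_le
        _ ≤ k := Nat.le_of_dvd (Nat.pos_of_ne_zero hk0') (Nat.prod_primeFactors_dvd k)
    have h5 : k.primeFactors.card * Real.log 2 ≤ Real.log k := by
      rw [← Real.log_pow]
      exact Real.log_le_log (by positivity) (by exact_mod_cast h4)
    have h6 := log_le_mul_of_le (X := 3000000) (l := 17) (by norm_num) (by norm_num) (by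
      rw [Real.log_le_iff_le_exp (by norm_num), ← Nat.cast_ofNat (R := ℝ) (n := 17),
        ← Real.exp_one_pow]
      have := Real.exp_one_gt_d9
      calc (3000000 : ℝ) ≤ 2.718 ^ 17 := by norm_num
        _ ≤ _ := by gcongr; linarith) hkbig
    have : (k.primeFactors.card : ℝ) * 0.69 ≤ k.primeFactors.card * Real.log 2 := by
      gcongr
      linarith
    linarith
  have hφ : 0.9603 * (k : ℝ) ≤ k.totient := by
    rw [le_div_iff₀ hk0, hT] at hF
    push_cast at hF
    linarith
  have hφ' : 0.9603 ≤ (k.totient : ℝ) / k := by rwa [le_div_iff₀ hk0]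
  refine ⟨hl, ht19, by linarith, by linarith, ?_, ?_, hφ⟩
  · intro p hp hpk
    have h4 := totient_div_le_one_sub_inv hk0' (Nat.mem_primeFactors.2 ⟨hp, hpk, hk0'⟩)
    by_contra! h5
    have h6 : p ≤ 23 := by
      by_contra! h6
      interval_cases p <;> revert hp <;> norm_num
    have h7 : (p : ℝ) ≤ 23 := by exact_mod_cast h6
    have h8 : (1 : ℝ) / 23 ≤ 1 / p :=
      one_div_le_one_div_of_le (by exact_mod_cast hp.pos) h7
    linarith
  · have h4 := totient_div_mul_exp_le hk0'
    generalize ∑ p ∈ k.primeFactors, (1 / p : ℝ) = s at h4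
    by_contra! h5
    have h6 : 0.9603 * (1 + s + s ^ 2 / 2) ≤ 1 := by
      refine le_trans ?_ h4
      gcongr
      exact Real.quadratic_le_exp_of_nonneg (by linarith)
    have h7 : 0.0408 ^ 2 ≤ s ^ 2 := by gcongr
    linarith

end PIntegerBound

namespace PIntegerBound

open Finset

lemma card_primeFactors_filter_le {k B : ℕ} {s : ℝ} (hs : ∑ p ∈ k.primeFactors, (1 / p : ℝ) ≤ s) :
    ((k.primeFactors.filter (· ≤ B)).card : ℝ) ≤ s * B := by
  rcases Nat.eq_zero_or_pos B with h | hB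
  · subst h
    rw [filter_false_of_mem]
    · simp
    · intro p hp h
      have := (Nat.prime_of_mem_primeFactors hp).pos
      omega
  have hB' : (0 : ℝ) < B := by exact_mod_cast hB
  have h1 : ((k.primeFactors.filter (· ≤ B)).card : ℝ) * (1 / B) ≤
      ∑ p ∈ k.primeFactors, (1 / p : ℝ) := by
    rw [← nsmul_eq_mul, ← sum_const]
    refine (sum_le_sum fun p hp => ?_).trans
      (sum_le_sum_of_subset_of_nonneg (filter_subset (· ≤ B) _) fun p _ _ => by positivity)
    rw [mem_filter] at hp
    exact one_div_le_one_div_of_le (by exact_mod_cast (Nat.prime_of_mem_primeFactors hp.1).pos)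
      (by exact_mod_cast hp.2)
  rw [mul_one_div, div_le_iff₀ hB'] at h1
  exact h1.trans (by gcongr)

lemma count_prime_le_card_add {k M B c : ℕ} (hk : k ≠ 0)
    (hc : (k.primeFactors.filter fun p => M < p ∧ p ≤ B).card ≤ c) :
    Nat.count Nat.Prime (B + 1) ≤ Nat.count Nat.Prime (M + 1) +
      ((Ioc M B).filter fun q => q.Prime ∧ ¬ q ∣ k).card + c := by
  classical
  rw [Nat.count_eq_card_filter_range, Nat.count_eq_card_filter_range]
  refine le_trans ?_ (Nat.add_le_add_left hc _)
  refine (card_le_card ?_).trans ((card_union_le _ _).trans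
    (Nat.add_le_add_right (card_union_le _ _) _))
  intro p hp
  simp only [mem_filter, mem_range, mem_union, mem_Ioc, Nat.mem_primeFactors] at hp ⊢
  by_cases h1 : p < M + 1
  · exact Or.inl (Or.inl ⟨h1, hp.2⟩)
  · by_cases h2 : p ∣ k
    · exact Or.inr ⟨⟨hp.2, h2, hk⟩, by omega, by omega⟩
    · exact Or.inl (Or.inr ⟨by omega, hp.2, h2⟩)

lemma Extremal.ne_zero {k t : ℕ} (h : Extremal k t) : k ≠ 0 := by
  rintro rfl
  have := h.lt_log
  norm_num at this

lemma Extremal.three_mul_card_le {k t : ℕ} (h : Extremal k t) :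
    3 * (k.primeFactors.card : ℝ) ≤ Real.log k := by
  have hk := h.ne_zero
  have h4 : 29 ^ k.primeFactors.card ≤ k := by
    calc 29 ^ k.primeFactors.card ≤ ∏ p ∈ k.primeFactors, p :=
          Finset.pow_card_le_prod _ _ _ fun p hp =>
            h.le_of_dvd p (Nat.prime_of_mem_primeFactors hp) (Nat.dvd_of_mem_primeFactors hp)
      _ ≤ k := Nat.le_of_dvd (Nat.pos_of_ne_zero hk) (Nat.prod_primeFactors_dvd k)
  have h5 : k.primeFactors.card * Real.log 29 ≤ Real.log k := by
    rw [← Real.log_pow]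
    exact Real.log_le_log (by positivity) (by exact_mod_cast h4)
  have h6 : 3 ≤ Real.log 29 := by
    rw [Real.le_log_iff_exp_le (by norm_num), ← Nat.cast_ofNat (R := ℝ) (n := 3),
      ← Real.exp_one_pow]
    have := Real.exp_one_lt_d9
    calc Real.exp 1 ^ 3 ≤ 2.72 ^ 3 := by gcongr; linarith
      _ ≤ 29 := by norm_num
  nlinarith [(Nat.cast_nonneg k.primeFactors.card : (0 : ℝ) ≤ _)]

lemma mul_sub_log_mono {a t : ℝ} (ha : 19 ≤ a) (hat : a ≤ t) :
    0.9604 * a - Real.log a ≤ 0.9604 * t - Real.log t := by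
  have ha0 : 0 < a := by linarith
  have h := Real.log_le_sub_one_of_pos (div_pos (ha0.trans_le hat) ha0)
  rw [Real.log_div (ha0.trans_le hat).ne' ha0.ne'] at h
  have : t / a - 1 ≤ 0.9604 * (t - a) := by
    rw [sub_le_iff_le_add, div_le_iff₀ ha0]
    nlinarith
  linarith

lemma Extremal.one_lt {k t : ℕ} (h : Extremal k t) : 1 < k := by
  have h1 := h.ne_zero
  rcases Nat.lt_or_ge 1 k with h2 | h2
  · exact h2
  · have h3 : k = 1 := by omega
    have h2 := h.lt_log
    rw [h3] at h2; norm_num at h2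

lemma Extremal.not_exists_prime {k t a b u B E : ℕ} (h : Extremal k t)
    (hcls : ∀ r < k, Nat.Coprime r k → ∃ i ≤ t, (r + i * k).Prime)
    (ha : 10 ≤ a) (hat : a ≤ (t + 1) / 2) (hbt : (t + 1) / 2 ≤ b)
    (hu : b < 29 ∧ 2 ≤ u ∨ 20000 + 816 * b < 10000 * (u + 1))
    (hc : Nat.count Nat.Prime (b + 1) + (u + 408 * B / 10000) ≤ Nat.count Nat.Prime (B + 1))
    (hE : (E : ℝ) ≤ 0.9604 * (2 * a - 1) + 0.93 - Real.log (2 * a - 1))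
    (hP : (primorial b * B ^ u * (2 * (2 * b / 3) + 3)) * 1000 ^ E ≤ 2718 ^ E) : False := by
  classical
  set M := (t + 1) / 2 with hM
  have hk := h.ne_zero
  have hk0 : (0 : ℝ) < k := by exact_mod_cast Nat.pos_of_ne_zero hk
  have hnd : ∀ p, p.Prime → p < 29 → ¬ p ∣ k := fun p hp hp' hd => by
    have := h.le_of_dvd p hp hd; omega
  have hk1 := h.one_lt
  set F := (Ioc M B).filter fun q => q.Prime ∧ ¬ q ∣ k with hF
  have hFc : u ≤ F.card := by
    have h1 : (k.primeFactors.filter fun p => M < p ∧ p ≤ B).card ≤ 408 * B / 10000 := by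
      rw [Nat.le_div_iff_mul_le (by norm_num)]
      have h1 := card_primeFactors_filter_le (B := B) h.sum_le
      have h2 : (k.primeFactors.filter fun p => M < p ∧ p ≤ B).card ≤
          (k.primeFactors.filter (· ≤ B)).card :=
        card_le_card fun p hp => by
          simp only [mem_filter] at hp ⊢; exact ⟨hp.1, hp.2.2⟩
      have h2' : ((k.primeFactors.filter fun p => M < p ∧ p ≤ B).card : ℝ) ≤
          (k.primeFactors.filter (· ≤ B)).card := by exact_mod_cast h2
      have : ((k.primeFactors.filter fun p => M < p ∧ p ≤ B).card : ℝ) * 10000 ≤ 408 * B := by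
        linarith
      exact_mod_cast this
    have h2 := count_prime_le_card_add hk h1
    have h3 := Nat.count_monotone Nat.Prime (show M + 1 ≤ b + 1 by omega)
    rw [← hF] at h2
    omega
  have hcount : 2 * (((Icc 1 M).filter fun n => ∀ p ∈ n.primeFactors, p ∈ (∅ : Finset ℕ) ∨
      p ∣ k).card : ℝ) * ∏ q ∈ (∅ : Finset ℕ), (1 - 1 / (q : ℝ)) < u + 1 := by
    rw [prod_empty, mul_one]
    rcases hu with ⟨hb, hu⟩ | hu
    · have h1 : ((Icc 1 M).filter fun n => ∀ p ∈ n.primeFactors, p ∈ (∅ : Finset ℕ) ∨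
          p ∣ k).card ≤ 1 := by
        refine (card_le_card (t := {1}) ?_).trans (by simp)
        intro n hn
        simp only [mem_filter, mem_Icc, notMem_empty, false_or] at hn
        rw [mem_singleton]
        by_contra hn1
        have h2 := Nat.minFac_prime hn1
        have h3 := hn.2 _ (Nat.mem_primeFactors.2 ⟨h2, n.minFac_dvd, by omega⟩)
        exact hnd _ h2 (lt_of_le_of_lt (Nat.minFac_le (by omega)) (by omega)) h3
      have h1' : (((Icc 1 M).filter fun n => ∀ p ∈ n.primeFactors, p ∈ (∅ : Finset ℕ) ∨
          p ∣ k).card : ℝ) ≤ 1 := by exact_mod_cast h1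
      have hu' : (2 : ℝ) ≤ u := by exact_mod_cast hu
      linarith
    · have h1 := card_filter_primeFactors_le hk ∅ M
      have h2 : ((smoothUpTo ∅ M).card : ℝ) ≤ 1 := by exact_mod_cast card_smoothUpTo_empty M
      have h3 : (M : ℝ) * ∑ p ∈ k.primeFactors, (1 / p : ℝ) ≤ b * 0.0408 := by
        have := h.sum_le
        have hMb : (M : ℝ) ≤ b := by exact_mod_cast hbt
        have : (0 : ℝ) ≤ ∑ p ∈ k.primeFactors, (1 / p : ℝ) := sum_nonneg fun p _ => by positivity
        gcongr
      have hu' : ((20000 + 816 * b : ℕ) : ℝ) < (10000 * (u + 1) : ℕ) := by exact_mod_cast hu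
      push_cast at hu'
      linarith
  have hB : 1 ≤ B := by
    by_contra! hB
    have : B + 1 = 1 := by omega
    rw [this] at hc
    have h1 : Nat.count Nat.Prime 1 = 0 := by decide
    have h2 : 2 ≤ u := by omega
    omega
  have key := lt_of_centred_cover (u := u) hk1 hcls (h.sum_le.trans (by norm_num))
    (show t ≤ 2 * M by omega) ∅ (by simp)
    ⟨2, by omega, Nat.prime_two, hnd 2 Nat.prime_two (by norm_num), by simp⟩ F
    (fun q hq => by
      rw [hF, mem_filter, mem_Ioc] at hq
      exact ⟨hq.2.1, hq.2.2, hq.1.1, hq.1.2⟩) hB hcount hFc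
  have hω : k.primeFactors.card ≤ 2 * b / 3 := by
    have h1 := h.three_mul_card_le.trans h.log_le
    have h2 : 3 * k.primeFactors.card ≤ t := by exact_mod_cast h1
    omega
  have h1 : k < primorial b * B ^ u * (2 * (2 * b / 3) + 3) :=
    key.trans_le (Nat.mul_le_mul (Nat.mul_le_mul_right _ (primorial_mono hbt)) (by omega))
  have h2 : k * 1000 ^ E < 2718 ^ E := (Nat.mul_lt_mul_of_pos_right h1 (by positivity)).trans_le hP
  have h3 : (k : ℝ) * 1000 ^ E < 2718 ^ E := by exact_mod_cast h2
  have h4 : (k : ℝ) < 2.718 ^ E := by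
    have : (2.718 : ℝ) ^ E = 2718 ^ E / 1000 ^ E := by rw [← div_pow]; norm_num
    rw [this, lt_div_iff₀ (by positivity)]
    exact h3
  have h5 : (2.718 : ℝ) ^ E ≤ Real.exp E := by
    rw [← Real.exp_one_pow]
    have := Real.exp_one_gt_d9
    gcongr
    linarith
  have h6 : Real.log k < E := (Real.log_lt_iff_lt_exp hk0).2 (h4.trans_le h5)
  have h7 := h.le_log
  have ha' : (10 : ℝ) ≤ a := by exact_mod_cast ha
  have hat' : (2 * a - 1 : ℝ) ≤ t := by
    have : 2 * a ≤ t + 1 := by omega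
    have : (2 * a : ℝ) ≤ t + 1 := by exact_mod_cast this
    linarith
  have := mul_sub_log_mono (by linarith) hat'
  linarith

/-- The product of the integers coprime to `Q` among `a, …, a + n - 1`. -/
noncomputable def coprimeProd (Q a : ℕ) : ℕ → ℕ
  | 0 => 1
  | n + 1 => Nat.mul (coprimeProd Q a n)
      (bif Nat.beq (Nat.gcd Q (Nat.add a n)) 1 then Nat.add a n else 1)

lemma primorial_le_mul_coprimeProd {Q q a : ℕ} (hQ : Q = primorial q) (hqa : q ≤ a) (n : ℕ) :
    primorial (a + n) ≤ primorial a * coprimeProd Q (a + 1) n := by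
  induction n with
  | zero => simp [coprimeProd]
  | succ n ih =>
    have e : coprimeProd Q (a + 1) (n + 1) = coprimeProd Q (a + 1) n *
      (bif Nat.beq (Nat.gcd Q (a + 1 + n)) 1 then a + 1 + n else 1) := rfl
    have h1 : primorial (a + (n + 1)) = primorial (a + n) *
        if (a + 1 + n).Prime then a + 1 + n else 1 := by
      rw [← add_assoc, primorial_add]
      congr 1
      rw [show Ico (a + n + 1) (a + n + 1 + 1) = {a + n + 1} by simp,
        show a + 1 + n = a + n + 1 by omega, filter_singleton]
      split_ifs
      · simp
      · simp
    rw [h1, e, ← mul_assoc]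
    refine Nat.mul_le_mul ih ?_
    split_ifs with hp
    · have : Nat.gcd Q (a + 1 + n) = 1 := by
        rw [Nat.gcd_comm]
        refine (Nat.Prime.coprime_iff_not_dvd hp).2 ?_
        rw [hQ, hp.dvd_primorial_iff]
        omega
      rw [this]
      exact le_rfl
    · cases Nat.beq (Nat.gcd Q (a + 1 + n)) 1
      · exact le_rfl
      · change 1 ≤ a + 1 + n
        omega

/-- Check a table with entries `(b, u, d, n, E, j)`, the previous value of `b` being `a`, and
`P` an upper bound for `primorial a`. -/
noncomputable def rowsCheck (Q q : ℕ) : List (ℕ × ℕ × ℕ × ℕ × ℕ × ℕ) → ℕ → ℕ → Bool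
  | [], _, _ => true
  | (b, u, d, n, E, j) :: l, a, P =>
    evalAt (fun B => evalAt (fun P' => Nat.ble a b && (
      (Nat.blt b 29 && Nat.ble 2 u || Nat.blt (20000 + 816 * b) (10000 * (u + 1))) && (
      Nat.ble (u + 408 * B / 10000) (coprimeBlocks Q d (2 * ((b + 1) / 2) + 1) n) && (
      Nat.ble (Nat.succ B) ((q + 1) ^ 2 + 1) && (
      Nat.ble ((2 * a + 1) * 1000 ^ j) (2718 ^ j) && (
      Nat.ble ((E + j) * 10000) (9604 * (2 * a + 1) + 9300) && (
      Nat.ble ((P' * B ^ u * (2 * (2 * b / 3) + 3)) * 1000 ^ E) (2718 ^ E) &&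
      rowsCheck Q q l b P')))))))
      (Nat.mul P (coprimeProd Q (Nat.succ a) (Nat.sub b a))))
      (2 * ((b + 1) / 2) + n * 2 ^ (d + 1))

/-- The last value of `b` in a table. -/
def rowsEnd : List (ℕ × ℕ × ℕ × ℕ × ℕ × ℕ) → ℕ → ℕ
  | [], a => a
  | (b, _) :: l, _ => rowsEnd l b

lemma Extremal.false_of_rowsCheck {k t Q q : ℕ} (h : Extremal k t)
    (hcls : ∀ r < k, Nat.Coprime r k → ∃ i ≤ t, (r + i * k).Prime) (hQ : Q = primorial q)
    (l : List (ℕ × ℕ × ℕ × ℕ × ℕ × ℕ)) {a P : ℕ} (ha : 9 ≤ a) (hqa : q ≤ a)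
    (hP : primorial a ≤ P) (hl : rowsCheck Q q l a P = true) (hat : a < (t + 1) / 2)
    (htl : (t + 1) / 2 ≤ rowsEnd l a) : False := by
  induction l generalizing a P with
  | nil => simp [rowsEnd] at htl; omega
  | cons e l ih =>
    obtain ⟨b, u, d, n, E, j⟩ := e
    simp only [rowsCheck, evalAt_eq, Bool.and_eq_true] at hl
    obtain ⟨h0, h1, h2, h3, h4, h5, h6, h7⟩ := hl
    set B := 2 * ((b + 1) / 2) + n * 2 ^ (d + 1) with hB
    set P' := Nat.mul P (coprimeProd Q (Nat.succ a) (Nat.sub b a)) with hP'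
    have h0 := Nat.le_of_ble_eq_true h0
    have hPb : primorial b ≤ P' := by
      have := primorial_le_mul_coprimeProd hQ hqa (b - a)
      rw [show a + (b - a) = b by omega] at this
      exact this.trans (Nat.mul_le_mul_right _ hP)
    rcases le_or_gt ((t + 1) / 2) b with htb | htb
    · refine h.not_exists_prime hcls (a := a + 1) (b := b) (u := u) (B := B) (E := E) (by omega)
        hat htb ?_ ?_ ?_ ?_
      · rw [Bool.or_eq_true, Bool.and_eq_true] at h1
        rcases h1 with ⟨h1, h1'⟩ | h1
        · exact Or.inl ⟨Nat.le_of_ble_eq_true h1, Nat.le_of_ble_eq_true h1'⟩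
        · exact Or.inr (Nat.le_of_ble_eq_true h1)
      · have h2 := Nat.le_of_ble_eq_true h2
        have h3 := Nat.le_of_ble_eq_true h3
        have := coprimeBlocks_le (Q := Q) (q := q + 1)
          (fun p hp hpp => by rw [hQ, hpp.dvd_primorial_iff]; omega) d
          (x := 2 * ((b + 1) / 2) + 1) (by omega) n (by omega)
        rw [show 2 * ((b + 1) / 2) + 1 + n * 2 ^ (d + 1) = B + 1 by omega] at this
        have h8 := Nat.count_monotone Nat.Prime (show b + 1 ≤ 2 * ((b + 1) / 2) + 1 by omega)
        omega
      · have h4 : (2 * a + 1) * 1000 ^ j ≤ 2718 ^ j := Nat.le_of_ble_eq_true h4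
        have h5 : (E + j) * 10000 ≤ 9604 * (2 * a + 1) + 9300 := Nat.le_of_ble_eq_true h5
        have h4' : ((2 * a + 1 : ℝ)) * 1000 ^ j ≤ 2718 ^ j := by exact_mod_cast h4
        have h5' : ((E + j : ℝ)) * 10000 ≤ 9604 * (2 * a + 1) + 9300 := by exact_mod_cast h5
        have h8 : Real.log (2 * (a + 1 : ℕ) - 1) ≤ j := by
          have e : (2 * ((a + 1 : ℕ) : ℝ) - 1) = 2 * a + 1 := by push_cast; ring
          rw [e, Real.log_le_iff_le_exp (by positivity), ← Real.exp_one_pow]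
          have h9 : (2 * a + 1 : ℝ) ≤ 2.718 ^ j := by
            have : (2.718 : ℝ) ^ j = 2718 ^ j / 1000 ^ j := by rw [← div_pow]; norm_num
            rwa [this, le_div_iff₀ (by positivity)]
          refine h9.trans ?_
          have := Real.exp_one_gt_d9
          gcongr
          linarith
        push_cast at h8 ⊢
        linarith
      · refine le_trans ?_ (Nat.le_of_ble_eq_true h6)
        gcongr
    · exact ih (by omega) (by omega) hPb h7 htb htl

/-- Table for `9 < M ≤ 24`. -/
def rows10 : List (ℕ × ℕ × ℕ × ℕ × ℕ × ℕ) :=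
  [(10, 2, 0, 2, 16, 3), (12, 2, 0, 3, 17, 4), (16, 2, 0, 2, 20, 4), (22, 2, 0, 5, 28, 4),
   (24, 2, 0, 7, 40, 4)]

/-- Table for `24 < M ≤ 105`. -/
def rows25 : List (ℕ × ℕ × ℕ × ℕ × ℕ × ℕ) :=
  [(30, 4, 0, 9, 43, 4), (36, 4, 0, 12, 54, 5), (46, 5, 0, 17, 66, 5), (60, 6, 0, 22, 85,
   5), (78, 8, 0, 31, 112, 5), (100, 10, 0, 41, 145, 6), (105, 10, 0, 44, 187, 6)]

/-- Table for `105 < M ≤ 455`. -/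
def rows106 : List (ℕ × ℕ × ℕ × ℕ × ℕ × ℕ) :=
  [(136, 13, 0, 61, 197, 6), (178, 16, 0, 86, 257, 6), (228, 20, 0, 111, 337, 6), (282, 25,
   0, 159, 432, 7), (355, 30, 0, 189, 536, 7), (441, 37, 0, 250, 676, 7), (455, 39, 0, 261,
   841, 7)]

/-- Table for `455 < M ≤ 3200`. -/
def rows456 : List (ℕ × ℕ × ℕ × ℕ × ℕ × ℕ) :=
  [(563, 47, 4, 21, 868, 7), (676, 57, 4, 27, 1075, 8), (816, 68, 4, 33, 1292, 8), (970, 81,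
   4, 41, 1561, 8), (1139, 94, 4, 49, 1857, 8), (1320, 109, 4, 60, 2181, 8), (1531, 126, 4,
   69, 2529, 8), (1752, 144, 4, 81, 2933, 9), (2002, 165, 4, 95, 3358, 9), (2276, 187, 4,
   111, 3838, 9), (2573, 211, 4, 127, 4364, 9), (2867, 235, 4, 147, 4935, 9), (3198, 262, 4,
   165, 5499, 9), (3200, 263, 4, 167, 6135, 9)]

lemma primorial_455 : primorial 455 = primorial456 := by decide +kernel

lemma rowsCheck_rows10 : rowsCheck 210 7 rows10 9 210 = true := by decide +kernel

lemma rowsCheck_rows25 : rowsCheck 9699690 22 rows25 24 223092870 = true := by decide +kernel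

lemma rowsCheck_rows106 : rowsCheck 13082761331670030 46 rows106 105
    23984823528925228172706521638692258396210 = true := by decide +kernel

lemma rowsCheck_rows456 : rowsCheck primorial456 455 rows456 455 primorial456 = true := by
  decide +kernel

lemma primorial_9 : primorial 9 = 210 := by decide +kernel

lemma primorial_22 : primorial 22 = 9699690 := by decide +kernel

lemma primorial_24 : primorial 24 = 223092870 := by decide +kernel

lemma primorial_46 : primorial 46 = 13082761331670030 := by decide +kernel

lemma primorial_105 : primorial 105 = 23984823528925228172706521638692258396210 := by
  decide +kernel

theorem Extremal.lt_half {k t : ℕ} (h : Extremal k t)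
    (hcls : ∀ r < k, Nat.Coprime r k → ∃ i ≤ t, (r + i * k).Prime) : 3200 < (t + 1) / 2 := by
  by_contra! ht
  have h19 : 19 ≤ t := h.le
  rcases le_or_gt ((t + 1) / 2) 24 with h1 | h1
  · exact h.false_of_rowsCheck hcls (show 210 = primorial 7 by decide) rows10 le_rfl (by norm_num)
      primorial_9.le rowsCheck_rows10 (by omega) h1
  rcases le_or_gt ((t + 1) / 2) 105 with h2 | h2
  · exact h.false_of_rowsCheck hcls primorial_22.symm rows25 (by norm_num) (by norm_num)
      primorial_24.le rowsCheck_rows25 h1 h2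
  rcases le_or_gt ((t + 1) / 2) 455 with h3 | h3
  · exact h.false_of_rowsCheck hcls primorial_46.symm rows106 (by norm_num) (by norm_num)
      primorial_105.le rowsCheck_rows106 h2 h3
  · exact h.false_of_rowsCheck hcls primorial_455.symm rows456 (by norm_num) le_rfl
      primorial_455.le rowsCheck_rows456 h3 ht

end PIntegerBound

namespace PIntegerBound

open Finset Chebyshev

lemma theta_sub_theta_le {k z B : ℕ} (hk : k ≠ 0) (hzB : z ≤ B) :
    θ B - θ z ≤ ((Ioc z B).filter fun q => q.Prime ∧ ¬ q ∣ k).card * Real.log B + Real.log k := by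
  classical
  have h1 : θ B = θ z + ∑ p ∈ (Ioc z B).filter Nat.Prime, Real.log p := by
    simp only [theta, Nat.floor_natCast, sum_filter]
    rw [← Finset.sum_Ioc_consecutive _ (Nat.zero_le z) hzB]
  have h2 : (Ioc z B).filter Nat.Prime ⊆
      ((Ioc z B).filter fun q => q.Prime ∧ ¬ q ∣ k) ∪ k.primeFactors := by
    intro p hp
    simp only [mem_filter, mem_union, Nat.mem_primeFactors] at hp ⊢
    tauto
  have h3 : ∑ p ∈ (Ioc z B).filter Nat.Prime, Real.log p ≤
      ∑ p ∈ (Ioc z B).filter (fun q => q.Prime ∧ ¬ q ∣ k), Real.log p +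
        ∑ p ∈ k.primeFactors, Real.log p := by
    refine (sum_le_sum_of_subset_of_nonneg h2 fun p _ _ => Real.log_natCast_nonneg p).trans ?_
    rw [← sum_union_inter]
    exact le_add_of_nonneg_right (sum_nonneg fun p _ => Real.log_natCast_nonneg p)
  have h4 : ∑ p ∈ (Ioc z B).filter (fun q => q.Prime ∧ ¬ q ∣ k), Real.log p ≤
      ((Ioc z B).filter fun q => q.Prime ∧ ¬ q ∣ k).card * Real.log B := by
    rw [← nsmul_eq_mul]
    refine sum_le_card_nsmul _ _ _ fun p hp => ?_
    simp only [mem_filter, mem_Ioc] at hp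
    exact Real.log_le_log (by exact_mod_cast hp.2.1.pos) (by exact_mod_cast hp.1.2)
  have h5 : ∑ p ∈ k.primeFactors, Real.log p ≤ Real.log k := by
    rw [← Real.log_prod fun p hp => by
      exact_mod_cast (Nat.prime_of_mem_primeFactors hp).ne_zero, ← Nat.cast_prod]
    have h6 := Nat.le_of_dvd (Nat.pos_of_ne_zero hk) (Nat.prod_primeFactors_dvd k)
    refine Real.log_le_log ?_ (by exact_mod_cast h6)
    exact_mod_cast Finset.prod_pos fun p hp => (Nat.prime_of_mem_primeFactors hp).pos
  linarith

lemma theta_le_mul (n : ℕ) : θ n ≤ 1.3863 * n := by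
  rw [theta_eq_log_primorial, Nat.floor_natCast]
  have h1 : Real.log (primorial n) ≤ Real.log (4 ^ n : ℕ) :=
    Real.log_le_log (by exact_mod_cast primorial_pos n) (by exact_mod_cast primorial_le_four_pow n)
  rw [Nat.cast_pow, Real.log_pow, Nat.cast_ofNat, show (4 : ℝ) = 2 ^ 2 by norm_num,
    Real.log_pow] at h1
  have h2 := Real.log_two_lt_d9
  have : (0 : ℝ) ≤ n := Nat.cast_nonneg n
  push_cast at h1
  nlinarith

lemma Extremal.log_le_of_lt {k t z B u : ℕ} (h : Extremal k t) (hB : 0 < B) (hBt : t + 3 ≤ B)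
    (hlt : k < primorial z * B ^ u * (2 * k.primeFactors.card + 3)) :
    Real.log k ≤ 1.3863 * z + (u + 1) * Real.log B := by
  have hk : (0 : ℝ) < k := by exact_mod_cast h.one_lt.le
  have hω : 2 * k.primeFactors.card + 3 ≤ B := by
    have h1 := h.three_mul_card_le.trans h.log_le
    have h2 : 3 * k.primeFactors.card ≤ t := by exact_mod_cast h1
    omega
  have h1 : k ≤ primorial z * B ^ (u + 1) := by
    rw [pow_succ, ← mul_assoc]
    exact hlt.le.trans (Nat.mul_le_mul_left _ hω)
  have hB' : (0 : ℝ) < B := by exact_mod_cast hB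
  have h2 : Real.log k ≤ Real.log (primorial z * B ^ (u + 1)) :=
    Real.log_le_log hk (by exact_mod_cast h1)
  rw [Real.log_mul (by exact_mod_cast (primorial_pos z).ne') (by positivity), Real.log_pow] at h2
  have h3 := theta_le_mul z
  rw [theta_eq_log_primorial, Nat.floor_natCast] at h3
  push_cast at h2
  linarith

lemma log_five_le : Real.log 5 ≤ 1.6095 := by
  have h := log_le_of_logUpper_le (n := 5) (u := 1609500000000) (by decide +kernel)
  norm_num at h ⊢
  linarith

/-- The centred cover leads to a contradiction when the set `R` of primes set aside is chosen
suitably. -/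
lemma Extremal.false_of_smoothUpTo {k t M : ℕ} (h : Extremal k t)
    (hcls : ∀ r < k, Nat.Coprime r k → ∃ i ≤ t, (r + i * k).Prime) (hM : M = (t + 1) / 2)
    (hM' : 3200 < M) (R : Finset ℕ) (hR : ∀ q ∈ R, q.Prime ∧ q ≤ 7) {S V y : ℝ}
    (hy : Real.log M = y) (hV : ∏ q ∈ R, (1 - 1 / (q : ℝ)) = V)
    (hS : ((smoothUpTo R M).card : ℝ) ≤ S)
    (hmain : (2 * V * (S + 0.0408 * M) + 2) * (y + 1.6095) + 0.04 ≤ 0.5345 * M) : False := by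
  classical
  have hk := h.ne_zero
  have hnd : ∀ p, p.Prime → p < 29 → ¬ p ∣ k := fun p hp hp' hd => by
    have := h.le_of_dvd p hp hd; omega
  have hM0 : (3200 : ℝ) < M := by exact_mod_cast hM'
  have hV0 : 0 ≤ V := by
    rw [← hV]
    refine prod_nonneg fun q hq => ?_
    have : (1 : ℝ) ≤ q := by exact_mod_cast (hR q hq).1.pos
    rw [sub_nonneg, div_le_one (by linarith)]; exact this
  have hS0 : 0 ≤ S := (Nat.cast_nonneg _).trans hS
  set U := 2 * V * (S + 0.0408 * M) with hU
  have hU0 : 0 ≤ U := by positivity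
  set u := ⌊U⌋₊ with hu
  have huU : (u : ℝ) ≤ U := Nat.floor_le hU0
  have hlog : Real.log (5 * M : ℕ) ≤ y + 1.6095 := by
    rw [Nat.cast_mul, Real.log_mul (by norm_num) (by linarith), hy]
    have := log_five_le
    push_cast
    linarith
  have hlog0 : 0 ≤ Real.log (5 * M : ℕ) := Real.log_natCast_nonneg _
  have hmain' : ((u : ℝ) + 2) * Real.log (5 * M : ℕ) + 0.04 ≤ 0.5345 * M := by
    refine le_trans ?_ hmain
    gcongr
  set F := (Ioc M (5 * M)).filter fun q => q.Prime ∧ ¬ q ∣ k with hF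
  have hlogk : Real.log k ≤ 2 * M := by
    refine h.log_le.trans ?_
    exact_mod_cast (show t ≤ 2 * M by omega)
  have hFc : u ≤ F.card := by
    have h1 := theta_sub_theta_le hk (show M ≤ 5 * M by omega)
    have h2 := theta_ge_of_ten_pow_four_le (x := (5 * M : ℕ)) (by push_cast; linarith)
    have h3 := theta_le_mul M
    rw [← hF] at h1
    have h4 : (u : ℝ) * Real.log (5 * M : ℕ) < F.card * Real.log (5 * M : ℕ) := by
      push_cast at *
      linarith
    have h5 := lt_of_mul_lt_mul_right h4 hlog0
    exact_mod_cast h5.le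
  have hcount : 2 * (((Icc 1 M).filter fun n => ∀ p ∈ n.primeFactors, p ∈ R ∨
      p ∣ k).card : ℝ) * ∏ q ∈ R, (1 - 1 / (q : ℝ)) < u + 1 := by
    rw [hV]
    refine lt_of_le_of_lt ?_ (Nat.lt_floor_add_one U)
    have h1 := card_filter_primeFactors_le hk R M
    have h2 := h.sum_le
    have h3 : (M : ℝ) * ∑ p ∈ k.primeFactors, (1 / p : ℝ) ≤ M * 0.0408 := by gcongr
    have h4 : (((Icc 1 M).filter fun n => ∀ p ∈ n.primeFactors, p ∈ R ∨
      p ∣ k).card : ℝ) ≤ S + 0.0408 * M := by linarith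
    rw [hU, mul_right_comm]
    gcongr
  have key := lt_of_centred_cover (u := u) h.one_lt hcls (h.sum_le.trans (by norm_num))
    (show t ≤ 2 * M by omega) R
    (fun q hq => ⟨(hR q hq).1, hnd q (hR q hq).1 (by linarith [(hR q hq).2]),
      by linarith [(hR q hq).2]⟩)
    ⟨11, by omega, by norm_num, hnd 11 (by norm_num) (by norm_num),
      fun hc => by have := (hR _ hc).2; omega⟩ F
    (fun q hq => by
      rw [hF, mem_filter, mem_Ioc] at hq
      exact ⟨hq.2.1, hq.2.2, hq.1.1, hq.1.2⟩) (by omega) hcount hFc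
  have h1 := h.log_le_of_lt (by omega) (by omega) key
  have h2 := h.le_log
  have h3 : (2 * M : ℝ) ≤ t + 1 := by exact_mod_cast (show 2 * M ≤ t + 1 by omega)
  have h4 : Real.log t ≤ Real.log (5 * M : ℕ) :=
    Real.log_le_log (by linarith) (by exact_mod_cast (show t ≤ 5 * M by omega))
  linarith

lemma log_five_ge : 1.6094 ≤ Real.log 5 := by
  have h := le_log_of_le_logLower (n := 5) (u := 1609400000000) (by decide +kernel)
  norm_num at h ⊢
  linarith

lemma log_seven_ge : 1.9459 ≤ Real.log 7 := by
  have h := le_log_of_le_logLower (n := 7) (u := 1945900000000) (by decide +kernel)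
  norm_num at h ⊢
  linarith

lemma natLog_le_mul {b M : ℕ} {c : ℝ} (hM : 1 ≤ M) (hc : 0 ≤ c) (hb : 1 ≤ c * Real.log b) :
    (Nat.log b M : ℝ) ≤ c * Real.log M := by
  have h1 : (Nat.log b M : ℝ) * Real.log b ≤ Real.log M := by
    rw [← Real.log_pow]
    have hb0 : b ≠ 0 := by rintro rfl; simp at hb; linarith
    exact Real.log_le_log (by positivity) (by exact_mod_cast Nat.pow_log_le_self b (by omega))
  have h2 : (0 : ℝ) ≤ Nat.log b M := Nat.cast_nonneg _
  nlinarith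

lemma natLog_two_le {M : ℕ} (hM : 1 ≤ M) : (Nat.log 2 M : ℝ) ≤ 1.4427 * Real.log M :=
  natLog_le_mul hM (by norm_num) (by have := Real.log_two_gt_d9; norm_num at *; linarith)

lemma natLog_three_le {M : ℕ} (hM : 1 ≤ M) : (Nat.log 3 M : ℝ) ≤ 0.9103 * Real.log M :=
  natLog_le_mul hM (by norm_num) (by have := log_three_bounds.1; norm_num at *; linarith)

lemma natLog_five_le {M : ℕ} (hM : 1 ≤ M) : (Nat.log 5 M : ℝ) ≤ 0.6214 * Real.log M :=
  natLog_le_mul hM (by norm_num) (by have := log_five_ge; norm_num at *; linarith)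

lemma natLog_seven_le {M : ℕ} (hM : 1 ≤ M) : (Nat.log 7 M : ℝ) ≤ 0.514 * Real.log M :=
  natLog_le_mul hM (by norm_num) (by have := log_seven_ge; norm_num at *; linarith)

lemma card_smoothUpTo_two_three_le {M : ℕ} (hM : 1 ≤ M) :
    ((smoothUpTo {2, 3} M).card : ℝ) ≤
      (1.4427 * Real.log M + 1) * (0.9103 * Real.log M + 1) := by
  have h1 := card_smoothUpTo_insert_le {3} Nat.prime_two M
  have h2 := card_smoothUpTo_insert_le ∅ Nat.prime_three M
  have h3 := card_smoothUpTo_empty M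
  have h4 : (smoothUpTo {2, 3} M).card ≤ (Nat.log 2 M + 1) * (Nat.log 3 M + 1) := by
    refine h1.trans (Nat.mul_le_mul_left _ (h2.trans ?_))
    nlinarith
  have h5 : ((smoothUpTo {2, 3} M).card : ℝ) ≤ (Nat.log 2 M + 1) * (Nat.log 3 M + 1) := by
    exact_mod_cast h4
  refine h5.trans ?_
  have := natLog_two_le hM
  have := natLog_three_le hM
  have : 0 ≤ Real.log M := Real.log_natCast_nonneg M
  gcongr

lemma card_smoothUpTo_seven_le {M : ℕ} (hM : 1 ≤ M) :
    ((smoothUpTo {5, 7, 2, 3} M).card : ℝ) ≤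
      (0.6214 * Real.log M + 1) * ((0.514 * Real.log M + 1) *
        ((1.4427 * Real.log M + 1) * (0.9103 * Real.log M + 1))) := by
  have h1 := card_smoothUpTo_insert_le {7, 2, 3} Nat.prime_five M
  have h2 := card_smoothUpTo_insert_le {2, 3} (q := 7) (by norm_num) M
  have h4 : (smoothUpTo {5, 7, 2, 3} M).card ≤ (Nat.log 5 M + 1) * ((Nat.log 7 M + 1) *
      (smoothUpTo {2, 3} M).card) := h1.trans (Nat.mul_le_mul_left _ h2)
  have h5 : ((smoothUpTo {5, 7, 2, 3} M).card : ℝ) ≤ (Nat.log 5 M + 1) * ((Nat.log 7 M + 1) *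
      (smoothUpTo {2, 3} M).card) := by exact_mod_cast h4
  refine h5.trans ?_
  have := natLog_five_le hM
  have := natLog_seven_le hM
  have := card_smoothUpTo_two_three_le hM
  have : 0 ≤ Real.log M := Real.log_natCast_nonneg M
  gcongr

lemma mul_le_of_log_le {X c y x : ℝ} (hX : 0 < X) (hx : 0 < x) (hXc : Real.log X ≤ c)
    (hxy : Real.log x = y) : X * (1 + (y - c)) ≤ x := by
  have h1 := Real.add_one_le_exp (y - c)
  have h2 : x = Real.exp c * Real.exp (y - c) := by
    rw [← Real.exp_add, ← hxy, add_sub_cancel, Real.exp_log hx]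
  have h3 : X ≤ Real.exp c := (Real.log_le_iff_le_exp hX).1 hXc
  rw [h2]
  rcases le_or_gt 0 (1 + (y - c)) with h4 | h4
  · exact mul_le_mul h3 (by linarith) h4 (Real.exp_pos _).le
  · exact (mul_nonpos_of_nonneg_of_nonpos hX.le h4.le).trans
      (mul_nonneg (Real.exp_pos _).le (Real.exp_pos _).le)

set_option maxHeartbeats 1000000 in
theorem Extremal.lt_log_half {k t M : ℕ} (h : Extremal k t)
    (hcls : ∀ r < k, Nat.Coprime r k → ∃ i ≤ t, (r + i * k).Prime) (hM : M = (t + 1) / 2) :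
    21.5 < Real.log M := by
  by_contra! hy
  have hM' : 3200 < M := hM ▸ h.lt_half hcls
  have hM0 : (3200 : ℝ) < M := by exact_mod_cast hM'
  have hM1 : (0 : ℝ) < M := by linarith
  have h2 := card_smoothUpTo_two_three_le (show 1 ≤ M by omega)
  have h7 := card_smoothUpTo_seven_le (show 1 ≤ M by omega)
  have hV2 : ∏ q ∈ ({2, 3} : Finset ℕ), (1 - 1 / (q : ℝ)) = 1 / 3 := by
    rw [prod_pair (by norm_num)]; norm_num
  have hV7 : ∏ q ∈ ({5, 7, 2, 3} : Finset ℕ), (1 - 1 / (q : ℝ)) = 8 / 35 := by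
    rw [prod_insert (by decide), prod_insert (by decide), hV2]; norm_num
  have hR2 : ∀ q ∈ ({2, 3} : Finset ℕ), q.Prime ∧ q ≤ 7 := by decide
  have hR7 : ∀ q ∈ ({5, 7, 2, 3} : Finset ℕ), q.Prime ∧ q ≤ 7 := by decide
  have hl1 : 8.07 ≤ Real.log 3200 := by
    have h := le_log_of_le_logLower (n := 3200) (u := 8070000000000) (by decide +kernel)
    norm_num at h ⊢
    linarith
  have hl2 : Real.log 3190 ≤ 8.07 := by
    have h := log_le_of_logUpper_le (n := 3190) (u := 8070000000000) (by decide +kernel)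
    norm_num at h ⊢
    linarith
  have hl3 : Real.log 14750 ≤ 9.6 := by
    have h := log_le_of_logUpper_le (n := 14750) (u := 9600000000000) (by decide +kernel)
    norm_num at h ⊢
    linarith
  have hl4 : Real.log 3600000 ≤ 15.1 := by
    have h := log_le_of_logUpper_le (n := 36) (u := 3583600000000) (by decide +kernel)
    have h' := log_ten_bounds.2
    rw [show (3600000 : ℝ) = 36 * 10 ^ 5 by norm_num, Real.log_mul (by norm_num) (by norm_num),
      Real.log_pow]
    norm_num at h ⊢
    linarith
  have hy1 : 8.07 ≤ Real.log M := hl1.trans (Real.log_le_log (by norm_num) hM0.le)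
  obtain ⟨y, hyy⟩ : ∃ y, Real.log M = y := ⟨_, rfl⟩
  have e1 := mul_le_of_log_le (by norm_num) hM1 hl2 hyy
  have e2 := mul_le_of_log_le (by norm_num) hM1 hl3 hyy
  have e3 := mul_le_of_log_le (by norm_num) hM1 hl4 hyy
  rw [hyy] at h2 h7 hy hy1
  rcases le_or_gt y 9.6 with c1 | c1
  · refine h.false_of_smoothUpTo hcls hM hM' _ hR2 hyy hV2 h2 ?_
    have p1 : (M : ℝ) * (y + 1.6095) ≤ M * (9.6 + 1.6095) := by gcongr
    obtain ⟨d, rfl⟩ : ∃ d, y = 8.07 + d := ⟨y - 8.07, by ring⟩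
    have d0 : 0 ≤ d := by linarith
    have d1 : d ≤ 1.53 := by linarith
    have d2 : d ^ 2 ≤ 1.53 * d := by nlinarith
    have d3 : d ^ 3 ≤ 1.53 * 1.53 * d := by nlinarith
    nlinarith
  rcases le_or_gt y 15.1 with c2 | c2
  · refine h.false_of_smoothUpTo hcls hM hM' _ hR2 hyy hV2 h2 ?_
    have p1 : (M : ℝ) * (y + 1.6095) ≤ M * (15.1 + 1.6095) := by gcongr
    obtain ⟨d, rfl⟩ : ∃ d, y = 9.6 + d := ⟨y - 9.6, by ring⟩
    have d0 : 0 ≤ d := by linarith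
    have d1 : d ≤ 5.5 := by linarith
    have d2 : d ^ 2 ≤ 5.5 * d := by nlinarith
    have d3 : d ^ 3 ≤ 5.5 * 5.5 * d := by nlinarith
    nlinarith
  · refine h.false_of_smoothUpTo hcls hM hM' _ hR7 hyy hV7 h7 ?_
    have p1 : (M : ℝ) * (y + 1.6095) ≤ M * (21.5 + 1.6095) := by gcongr
    obtain ⟨d, rfl⟩ : ∃ d, y = 15.1 + d := ⟨y - 15.1, by ring⟩
    have d0 : 0 ≤ d := by linarith
    have d1 : d ≤ 6.4 := by linarith
    have d2 : d ^ 2 ≤ 6.4 * d := by nlinarith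
    have d3 : d ^ 3 ≤ 6.4 * d ^ 2 := by nlinarith [sq_nonneg d]
    have d4 : d ^ 4 ≤ 6.4 * d ^ 3 := by nlinarith [pow_nonneg d0 3]
    have d5 : d ^ 5 ≤ 6.4 * d ^ 4 := by nlinarith [pow_nonneg d0 4]
    nlinarith

end PIntegerBound

namespace PIntegerBound

open Finset
open scoped Nat ArithmeticFunction.vonMangoldt

lemma mul_log_sub_le_log_factorial (n : ℕ) :
    n * Real.log (n + 1) - n ≤ Real.log (n ! : ℝ) := by
  induction n with
  | zero => simp
  | succ n ih =>
    rw [Nat.factorial_succ, Nat.cast_mul, Real.log_mul (by positivity) (by positivity)]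
    have h1 : (0 : ℝ) < n + 1 := by positivity
    have h := Real.log_le_sub_one_of_pos (show (0 : ℝ) < (n + 1 + 1) / (n + 1) by positivity)
    rw [Real.log_div (by positivity) (by positivity)] at h
    have h2 : ((n : ℝ) + 1 + 1) / (n + 1) - 1 = 1 / (n + 1) := by field_simp; ring
    rw [h2] at h
    have h3 := mul_le_mul_of_nonneg_left h h1.le
    rw [mul_one_div_cancel h1.ne'] at h3
    push_cast
    linarith

lemma log_sub_one_le_sum_vonMangoldt_div {n : ℕ} (hn : 1 ≤ n) :
    Real.log (n + 1) - 1 ≤ ∑ d ∈ Icc 1 n, Λ d / d := by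
  have h1 := mul_log_sub_le_log_factorial n
  have h2 : Real.log (n ! : ℝ) ≤ n * ∑ d ∈ Icc 1 n, Λ d / d := by
    rw [log_factorial_eq_sum, mul_sum]
    refine sum_le_sum fun d _ => ?_
    rw [mul_div_left_comm]
    exact mul_le_mul_of_nonneg_left Nat.cast_div_le ArithmeticFunction.vonMangoldt_nonneg
  have h3 : (0 : ℝ) < n := by exact_mod_cast hn
  have h4 : n * (Real.log (n + 1) - 1) ≤ n * ∑ d ∈ Icc 1 n, Λ d / d := by linarith
  exact le_of_mul_le_mul_left h4 h3

lemma sum_vonMangoldt_div_mul_log_le (N : ℕ) :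
    ∑ d ∈ Icc 1 N, Λ d / (d * Real.log d) ≤
      ∑ p ∈ (range (N + 1)).filter Nat.Prime, -Real.log (1 - 1 / p) := by
  classical
  set f : ℕ → ℝ := fun d => Λ d / (d * Real.log d) with hf
  have hf0 : ∀ d, 0 ≤ f d := fun d => div_nonneg ArithmeticFunction.vonMangoldt_nonneg
    (mul_nonneg (Nat.cast_nonneg d) (Real.log_natCast_nonneg d))
  set P := (range (N + 1)).filter Nat.Prime with hP
  set g : ℕ × ℕ → ℕ := fun x => x.1 ^ (x.2 + 1) with hg
  have h1 : ∑ d ∈ Icc 1 N, f d = ∑ d ∈ (Icc 1 N).filter IsPrimePow, f d := by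
    refine (sum_filter_of_ne fun d _ hd => ?_).symm
    by_contra h
    rw [← ArithmeticFunction.vonMangoldt_eq_zero_iff] at h
    exact hd (by simp [hf, h])
  have h2 : (Icc 1 N).filter IsPrimePow ⊆ (P ×ˢ range N).image g := by
    intro d hd
    rw [mem_filter, mem_Icc] at hd
    obtain ⟨p, j, hp, hj, rfl⟩ := (isPrimePow_nat_iff d).1 hd.2
    rw [mem_image]
    have h3 : p ≤ p ^ j := Nat.le_self_pow hj.ne' p
    have h4 : j < p ^ j := Nat.lt_pow_self hp.one_lt
    refine ⟨(p, j - 1), ?_, ?_⟩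
    · simp only [hP, mem_product, mem_filter, mem_range]
      exact ⟨⟨by omega, hp⟩, by omega⟩
    · simp only [hg]; congr 1; omega
  have hinj : Set.InjOn g (P ×ˢ range N : Finset (ℕ × ℕ)) := by
    rintro ⟨p, i⟩ hx ⟨q, j⟩ hy hxy
    simp only [hP, mem_coe, mem_product, mem_filter] at hx hy
    simp only [hg] at hxy
    have hpq : p = q := by
      have : p ∣ q ^ (j + 1) := hxy ▸ dvd_pow_self p (Nat.succ_ne_zero i)
      exact (Nat.prime_dvd_prime_iff_eq hx.1.2 hy.1.2).1 (hx.1.2.dvd_of_dvd_pow this)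
    subst hpq
    have := Nat.pow_right_injective hx.1.2.two_le hxy
    simp only [Prod.mk.injEq, true_and]
    omega
  rw [h1]
  refine (sum_le_sum_of_subset_of_nonneg h2 fun d _ _ => hf0 d).trans ?_
  rw [sum_image hinj, sum_product]
  refine sum_le_sum fun p hp => ?_
  have hp := (mem_filter.1 hp).2
  have hp1 : (1 : ℝ) < p := by exact_mod_cast hp.one_lt
  have hlog := Real.log_pos hp1
  have habs : |1 / (p : ℝ)| < 1 := by
    rw [abs_of_pos (by positivity), div_lt_one (by linarith)]
    exact hp1
  refine le_trans (le_of_eq ?_) (sum_le_hasSum (range N) (fun i _ => by positivity)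
    (Real.hasSum_pow_div_log_of_abs_lt_one habs))
  refine sum_congr rfl fun j _ => ?_
  simp only [hf, hg]
  rw [ArithmeticFunction.vonMangoldt_apply_pow (Nat.succ_ne_zero j),
    ArithmeticFunction.vonMangoldt_apply_prime hp, Nat.cast_pow, Real.log_pow]
  push_cast
  field_simp
  rw [← mul_pow, mul_one_div_cancel (by linarith), one_pow]

lemma log_log_add_le_of_le {x₀ N : ℕ} {K : ℝ} (hx₀ : 1 ≤ x₀) (hN : x₀ ≤ N)
    (hK : K = ∑ d ∈ Icc 1 x₀, Λ d / (d * Real.log d) - Real.log (Real.log (x₀ + 1)) -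
      (∑ d ∈ Icc 1 x₀, Λ d / d - Real.log (x₀ + 1) + 1) / Real.log (x₀ + 1)) :
    K + Real.log (Real.log (N + 1)) + (∑ d ∈ Icc 1 N, Λ d / d - Real.log (N + 1) + 1) /
      Real.log (N + 1) ≤ ∑ d ∈ Icc 1 N, Λ d / (d * Real.log d) := by
  induction N, hN using Nat.le_induction with
  | base => rw [hK]; linarith
  | succ N hN ih =>
    rw [sum_Icc_succ_top (by omega), sum_Icc_succ_top (by omega)]
    have hA := log_sub_one_le_sum_vonMangoldt_div (n := N + 1) (by omega)
    rw [sum_Icc_succ_top (by omega)] at hA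
    generalize ∑ d ∈ Icc 1 N, Λ d / d = A at *
    generalize ∑ d ∈ Icc 1 N, Λ d / (d * Real.log d) = S at *
    have hN1 : (1 : ℝ) ≤ N := by exact_mod_cast hx₀.trans hN
    push_cast at hA ⊢
    have hl1 : 0 < Real.log ((N : ℝ) + 1) := Real.log_pos (by linarith)
    have hl2 : Real.log ((N : ℝ) + 1) ≤ Real.log ((N : ℝ) + 1 + 1) :=
      Real.log_le_log (by linarith) (by linarith)
    rw [show Λ (N + 1) / (((N : ℝ) + 1) * Real.log ((N : ℝ) + 1)) =
      Λ (N + 1) / ((N : ℝ) + 1) / Real.log ((N : ℝ) + 1) by rw [div_div]]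
    generalize Λ (N + 1) / ((N : ℝ) + 1) = a at *
    generalize Real.log ((N : ℝ) + 1) = l at *
    generalize Real.log ((N : ℝ) + 1 + 1) = m at *
    have hm : 0 < m := hl1.trans_le hl2
    have h1 := Real.log_le_sub_one_of_pos (div_pos hm hl1)
    rw [Real.log_div hm.ne' hl1.ne'] at h1
    have h2 : (A + a - m + 1) / m ≤ (A + a - m + 1) / l :=
      div_le_div_of_nonneg_left (by linarith) hl1 hl2
    have h3 : (A + a - m + 1) / l = (A - l + 1) / l + a / l - (m / l - 1) := by
      field_simp; ring
    linarith

lemma log_log_ten_le : Real.log (Real.log 10) ≤ 0.8343 := by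
  have h0 := log_ten_bounds
  have h1 := Real.log_le_sub_one_of_pos (show 0 < Real.log 10 / 2.3 from
    div_pos (by linarith) (by norm_num))
  rw [Real.log_div (by linarith) (by norm_num)] at h1
  have h2 : Real.log 10 / 2.3 ≤ 1.00113 := by rw [div_le_iff₀ (by norm_num)]; linarith
  have h3 := log_le_of_logUpper_le (n := 23) (u := 3135500000000) (by decide +kernel)
  have h4 : Real.log 2.3 = Real.log 23 - Real.log 10 := by
    rw [← Real.log_div (by norm_num) (by norm_num)]; norm_num
  norm_num at h3
  linarith

lemma log_seven_le : Real.log 7 ≤ 1.946 := by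
  have h := log_le_of_logUpper_le (n := 7) (u := 1946000000000) (by decide +kernel)
  norm_num at h ⊢
  linarith

/-- An explicit form of Mertens' theorem. -/
lemma prod_one_sub_inv_le {z : ℕ} (hz : 9 ≤ z) :
    ∏ p ∈ (range (z + 1)).filter Nat.Prime, (1 - 1 / (p : ℝ)) ≤ 0.681 / Real.log (z + 1) := by
  have hz1 : (9 : ℝ) ≤ z := by exact_mod_cast hz
  have hlog : 0 < Real.log ((z : ℝ) + 1) := Real.log_pos (by linarith)
  have h1 := log_log_add_le_of_le (x₀ := 9) (by norm_num) hz rfl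
  have h2 := sum_vonMangoldt_div_mul_log_le z
  have h3 := log_sub_one_le_sum_vonMangoldt_div (show 1 ≤ z by omega)
  have h4 : 0 ≤ (∑ d ∈ Icc 1 z, Λ d / d - Real.log (z + 1) + 1) / Real.log (z + 1) :=
    div_nonneg (by linarith) hlog.le
  have v1 : Λ 1 = 0 := ArithmeticFunction.vonMangoldt_apply_one
  have v2 : Λ 2 = Real.log 2 := ArithmeticFunction.vonMangoldt_apply_prime (by norm_num)
  have v3 : Λ 3 = Real.log 3 := ArithmeticFunction.vonMangoldt_apply_prime (by norm_num)
  have v4 : Λ 4 = Real.log 2 := by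
    rw [show 4 = 2 ^ 2 by norm_num, ArithmeticFunction.vonMangoldt_apply_pow (by norm_num), v2]
  have v5 : Λ 5 = Real.log 5 := ArithmeticFunction.vonMangoldt_apply_prime (by norm_num)
  have v6 : Λ 6 = 0 := by
    rw [ArithmeticFunction.vonMangoldt_eq_zero_iff, isPrimePow_nat_iff_bounded]
    decide
  have v7 : Λ 7 = Real.log 7 := ArithmeticFunction.vonMangoldt_apply_prime (by norm_num)
  have v8 : Λ 8 = Real.log 2 := by
    rw [show 8 = 2 ^ 3 by norm_num, ArithmeticFunction.vonMangoldt_apply_pow (by norm_num), v2]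
  have v9 : Λ 9 = Real.log 3 := by
    rw [show 9 = 3 ^ 2 by norm_num, ArithmeticFunction.vonMangoldt_apply_pow (by norm_num), v3]
  have l2 : 0 < Real.log 2 := Real.log_pos (by norm_num)
  have l3 : 0 < Real.log 3 := Real.log_pos (by norm_num)
  have l5 : 0 < Real.log 5 := Real.log_pos (by norm_num)
  have l7 : 0 < Real.log 7 := Real.log_pos (by norm_num)
  have l4 : Real.log 4 = 2 * Real.log 2 := by
    rw [show (4 : ℝ) = 2 ^ 2 by norm_num, Real.log_pow]; norm_num
  have l8 : Real.log 8 = 3 * Real.log 2 := by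
    rw [show (8 : ℝ) = 2 ^ 3 by norm_num, Real.log_pow]; norm_num
  have l9 : Real.log 9 = 2 * Real.log 3 := by
    rw [show (9 : ℝ) = 3 ^ 2 by norm_num, Real.log_pow]; norm_num
  have hS : ∑ d ∈ Icc 1 9, Λ d / (d * Real.log d) =
      1 / 2 + 1 / 3 + 1 / 8 + 1 / 5 + 1 / 7 + 1 / 24 + 1 / 18 := by
    simp only [show Icc 1 9 = ({1, 2, 3, 4, 5, 6, 7, 8, 9} : Finset ℕ) by decide]
    rw [sum_insert (by decide), sum_insert (by decide), sum_insert (by decide),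
      sum_insert (by decide), sum_insert (by decide), sum_insert (by decide),
      sum_insert (by decide), sum_insert (by decide), sum_singleton,
      v1, v2, v3, v4, v5, v6, v7, v8, v9]
    push_cast
    rw [l4, l8, l9, zero_div, zero_div]
    field_simp
    norm_num
  have hA : ∑ d ∈ Icc 1 9, Λ d / (d : ℝ) ≤ 1.6948 := by
    simp only [show Icc 1 9 = ({1, 2, 3, 4, 5, 6, 7, 8, 9} : Finset ℕ) by decide]
    rw [sum_insert (by decide), sum_insert (by decide), sum_insert (by decide),
      sum_insert (by decide), sum_insert (by decide), sum_insert (by decide),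
      sum_insert (by decide), sum_insert (by decide), sum_singleton,
      v1, v2, v3, v4, v5, v6, v7, v8, v9]
    push_cast
    have := Real.log_two_lt_d9
    have := log_three_bounds.2
    have := log_five_le
    have := log_seven_le
    linarith
  have h10 := log_ten_bounds
  rw [show ((9 : ℕ) : ℝ) + 1 = 10 by norm_num, hS] at h1
  have h5 : (∑ d ∈ Icc 1 9, Λ d / (d : ℝ) - Real.log 10 + 1) / Real.log 10 ≤ 0.1706 := by
    rw [div_le_iff₀ (by linarith)]
    linarith
  have h6 := log_log_ten_le
  have h7 : Real.log (Real.log (z + 1)) + 0.385 ≤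
      ∑ p ∈ (range (z + 1)).filter Nat.Prime, -Real.log (1 - 1 / p) := by
    linarith
  have hpos : ∀ p ∈ (range (z + 1)).filter Nat.Prime, 0 < 1 - 1 / (p : ℝ) := by
    intro p hp
    have : (1 : ℝ) < p := by exact_mod_cast (mem_filter.1 hp).2.one_lt
    rw [sub_pos, div_lt_one (by linarith)]
    exact this
  rw [sum_neg_distrib, ← Real.log_prod fun p hp => (hpos p hp).ne'] at h7
  have hprod := prod_pos hpos
  have h8 : -(0.385 : ℝ) ≤ Real.log 0.681 := by
    have h := Real.log_le_sub_one_of_pos (show (0 : ℝ) < 0.681⁻¹ / (1.47) by norm_num)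
    rw [Real.log_div (by norm_num) (by norm_num), Real.log_inv] at h
    have e : Real.log 1.47 = Real.log 3 + 2 * Real.log 7 - 2 * Real.log 10 := by
      rw [← Real.log_rpow (by norm_num), ← Real.log_rpow (by norm_num),
        ← Real.log_mul (by norm_num) (by norm_num), ← Real.log_div (by norm_num) (by norm_num)]
      norm_num
    have := log_three_bounds.2
    have : Real.log 7 ≤ 1.94592 := by
      have h := log_le_of_logUpper_le (n := 7) (u := 1945920000000) (by decide +kernel)
      norm_num at h ⊢
      linarith
    norm_num at h
    linarith
  rw [← Real.log_le_log_iff hprod (by positivity), Real.log_div (by norm_num) hlog.ne']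
  linarith

end PIntegerBound

namespace PIntegerBound

open Finset Chebyshev

lemma Extremal.prod_mul_le {k t z : ℕ} (h : Extremal k t) :
    (∏ q ∈ (range (z + 1)).filter (fun q => q.Prime ∧ ¬ q ∣ k), (1 - 1 / (q : ℝ))) * 0.9603 ≤
      ∏ q ∈ (range (z + 1)).filter Nat.Prime, (1 - 1 / (q : ℝ)) := by
  classical
  have hk := h.ne_zero
  have hk0 : (0 : ℝ) < k := by exact_mod_cast Nat.pos_of_ne_zero hk
  have hnn : ∀ p : ℕ, p.Prime → 0 ≤ 1 - 1 / (p : ℝ) := fun p hp => by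
    have : (1 : ℝ) < p := by exact_mod_cast hp.one_lt
    rw [sub_nonneg, div_le_one (by linarith)]
    exact this.le
  have h1 : 0.9603 ≤ ∏ p ∈ k.primeFactors, (1 - 1 / (p : ℝ)) := by
    have h2 := h.le_totient
    rw [totient_eq_mul_prod, mul_comm] at h2
    simp only [one_div]
    exact le_of_mul_le_mul_left h2 hk0
  have h2 : ∏ p ∈ k.primeFactors, (1 - 1 / (p : ℝ)) ≤
      ∏ p ∈ ((range (z + 1)).filter Nat.Prime).filter (· ∣ k), (1 - 1 / (p : ℝ)) := by
    have hsub : ((range (z + 1)).filter Nat.Prime).filter (· ∣ k) ⊆ k.primeFactors := by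
      intro p hp
      simp only [mem_filter] at hp
      exact Nat.mem_primeFactors.2 ⟨hp.1.2, hp.2, hk⟩
    rw [← prod_sdiff hsub]
    refine mul_le_of_le_one_left (prod_nonneg fun p hp => ?_) (Finset.prod_le_one
      (fun p hp => ?_) fun p hp => ?_)
    · exact hnn p (mem_filter.1 (mem_filter.1 hp).1).2
    · exact hnn p (Nat.prime_of_mem_primeFactors (mem_sdiff.1 hp).1)
    · rw [sub_le_self_iff]; positivity
  rw [← prod_filter_mul_prod_filter_not ((range (z + 1)).filter Nat.Prime) (· ∣ k), mul_comm,
    ← filter_filter]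
  refine mul_le_mul_of_nonneg_right (h1.trans h2) (prod_nonneg fun p hp => ?_)
  exact hnn p (mem_filter.1 (mem_filter.1 hp).1).2

theorem Extremal.not_forall_exists_prime {k t : ℕ} (h : Extremal k t)
    (hcls : ∀ r < k, Nat.Coprime r k → ∃ i ≤ t, (r + i * k).Prime) : False := by
  classical
  have hk := h.ne_zero
  have h10 := log_ten_bounds
  have hl2 := Real.log_two_lt_d9
  have ht : (3900000000 : ℝ) ≤ t := by
    have h1 := h.lt_log_half hcls rfl
    have h2 : Real.log 2000000000 ≤ 21.5 := by
      rw [show (2000000000 : ℝ) = 2 * 10 ^ 9 by norm_num, Real.log_mul (by norm_num) (by norm_num),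
        Real.log_pow]
      norm_num
      linarith
    have h3 : (2000000000 : ℝ) < ((t + 1) / 2 : ℕ) := by
      have h0 : 0 < (t + 1) / 2 := by have := h.le; omega
      exact (Real.log_lt_log_iff (by norm_num) (by exact_mod_cast h0)).1 (h2.trans_lt h1)
    have h4 : (((t + 1) / 2 : ℕ) : ℝ) ≤ (t + 1 : ℕ) / 2 := Nat.cast_div_le
    push_cast at h4
    linarith
  obtain ⟨z, hz⟩ : ∃ z, z = t / 20 := ⟨_, rfl⟩
  have hz1 : (z : ℝ) ≤ t / 20 := by
    have : (20 * z : ℝ) ≤ t := by exact_mod_cast (show 20 * z ≤ t by omega)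
    linarith
  have hz2 : (t : ℝ) / 20 ≤ z + 1 := by
    have : (t : ℝ) ≤ 20 * (z + 1) := by exact_mod_cast (show t ≤ 20 * (z + 1) by omega)
    linarith
  have hz9 : 9 ≤ z := by
    have : (9 : ℝ) < z := by linarith
    exact_mod_cast this.le
  set L := Real.log ((z : ℝ) + 1) with hL
  have hL0 : 18.4206 ≤ L := by
    have h1 : Real.log (10 ^ 8) ≤ L := Real.log_le_log (by norm_num) (by linarith)
    rw [Real.log_pow] at h1
    push_cast at h1
    linarith
  have hB : Real.log (4 * t : ℕ) ≤ 1.238 * L := by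
    have h1 : Real.log (4 * t : ℕ) ≤ Real.log (2 ^ 3 * 10 * ((z : ℝ) + 1)) :=
      Real.log_le_log (by push_cast; linarith) (by push_cast; linarith)
    rw [Real.log_mul (by norm_num) (by linarith), Real.log_mul (by norm_num) (by norm_num),
      Real.log_pow] at h1
    push_cast at h1 ⊢
    linarith
  have hB0 : 0 ≤ Real.log (4 * t : ℕ) := Real.log_natCast_nonneg _
  have hBs : Real.log (4 * t : ℕ) ≤ 0.001 * t := by
    have h1 := log_le_mul_of_le (X := 10 ^ 10) (l := 23.1) (x := (4 * t : ℕ)) (by norm_num)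
      (by norm_num) (by rw [Real.log_pow]; push_cast; linarith) (by push_cast; linarith)
    refine h1.trans ?_
    push_cast
    linarith
  set U := (t + 1) * (0.681 / L / 0.9603) with hU
  have hU0 : 0 ≤ U := by positivity
  have huU := Nat.floor_le hU0
  set u := ⌊U⌋₊ with hu
  have hUB : u * Real.log (4 * t : ℕ) ≤ 0.878 * (t + 1) := by
    calc u * Real.log (4 * t : ℕ) ≤ U * (1.238 * L) := by gcongr
      _ = (0.681 * 1.238 / 0.9603) * (t + 1) := by rw [hU]; field_simp
      _ ≤ 0.878 * (t + 1) := by gcongr; norm_num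
  have hlogt : Real.log t ≤ Real.log (4 * t : ℕ) :=
    Real.log_le_log (by linarith) (by push_cast; linarith)
  set F := (Ioc z (4 * t)).filter fun q => q.Prime ∧ ¬ q ∣ k with hF
  have hFc : u ≤ F.card := by
    have h1 := theta_sub_theta_le hk (show z ≤ 4 * t by omega)
    have h2 := theta_ge_of_five_mul_ten_pow_six_le (x := (4 * t : ℕ)) (by push_cast; linarith)
    have h3 := theta_le_mul z
    have h4 := h.log_le
    rw [← hF] at h1
    have h5 : (u : ℝ) * Real.log (4 * t : ℕ) < F.card * Real.log (4 * t : ℕ) := by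
      have e : ((4 * t : ℕ) : ℝ) = 4 * t := by push_cast; ring
      linarith
    exact_mod_cast (lt_of_mul_lt_mul_right h5 hB0).le
  have hprod : ∏ q ∈ (range (z + 1)).filter (fun q => q.Prime ∧ ¬ q ∣ k), (1 - 1 / (q : ℝ)) ≤
      0.681 / L / 0.9603 := by
    rw [le_div_iff₀ (by norm_num)]
    exact h.prod_mul_le.trans (prod_one_sub_inv_le hz9)
  have hcount : (t + 1 : ℝ) * ∏ q ∈ (range (z + 1)).filter (fun q => q.Prime ∧ ¬ q ∣ k),
      (1 - 1 / (q : ℝ)) < u + 1 := by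
    refine lt_of_le_of_lt ?_ (Nat.lt_floor_add_one U)
    exact mul_le_mul_of_nonneg_left hprod (by positivity)
  have key := lt_of_averaged_cover h.one_lt hcls (h.sum_le.trans (by norm_num)) F
    (fun q hq => by
      rw [hF, mem_filter, mem_Ioc] at hq
      exact ⟨hq.2.1, hq.2.2, hq.1.1, hq.1.2⟩) (by omega) hcount hFc
  have h1 := h.log_le_of_lt (by omega) (by omega) key
  have h2 := h.le_log
  linarith

end PIntegerBound

theorem t_lt_log_k_log_k (k : ℕ) (hk : 30 < k) (hP : IsPInteger k) (T t : ℕ)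
    (hT : T = k.totient + k.primeFactors.card) (ht : t = nthPrime T / k) :
    (t : ℝ) < Real.log (k * Real.log k) := by
  subst ht
  have hT0 : 0 < T := by
    have := Nat.totient_pos.2 (show 0 < k by omega)
    omega
  have hπ := PIntegerBound.primeCounting_mul_div_le k T hT0
  rcases le_or_gt (Real.log k) 15.5 with hl | hl
  · exact PIntegerBound.not_log_le_of_log_le hk hl
      (hπ.trans (hT.le.trans (PIntegerBound.totient_add_card_primeFactors_le (by omega))))
  · by_contra! h
    exact (PIntegerBound.extremal hl h (hT ▸ hπ)).not_forall_exists_prime fun r hr hc =>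
      PIntegerBound.IsPInteger.exists_prime_in_class hP hT hr hc
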